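/- arXiv:2101.11304 — 5 statements merged into one kernel-verified Lean document; each statement's English description precedes it below -/
import Mathlib

section
/- Let n ≥ 5 be an integer and let v : ℝ → (0,∞) be a C⁴ solution of the Delaunay ODE v''''(t) − ((n(n−4)+8)/2) v''(t) + (n²(n−4)²/16) v(t) = (n(n−4)(n²−4)/16) v(t)^{(n+4)/(n−4)} on an open interval (a,b). Then the reduced Hamiltonian H̄(v)(t) = −v'(t)v'''(t) + (1/2)(v''(t))² + ((n(n−4)+8)/4)(v'(t))² − (n²(n−4)²/32) v(t)² + ((n−4)²(n²−4)/32) v(t)^{2n/(n−4)} is constant in t ∈ (a,b). -/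
/-- The reduced Hamiltonian
`H̄(v)(t) = −v'(t)v'''(t) + (1/2)(v''(t))² + ((n(n−4)+8)/4)(v'(t))²
  − (n²(n−4)²/32) v(t)² + ((n−4)²(n²−4)/32) v(t)^{2n/(n−4)}`. -/
noncomputable def redHam (n : ℕ) (v : ℝ → ℝ) (t : ℝ) : ℝ :=
  -(deriv v t) * iteratedDeriv 3 v t + (1/2) * (iteratedDeriv 2 v t)^2
    + (((n : ℝ) * ((n : ℝ) - 4) + 8)/4) * (deriv v t)^2
    - ((n : ℝ)^2 * ((n : ℝ) - 4)^2/32) * (v t)^2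
    + (((n : ℝ) - 4)^2 * ((n : ℝ)^2 - 4)/32) * v t ^ ((2 * (n : ℝ))/((n : ℝ) - 4))

/-- The Delaunay ODE
`v'''' − ((n(n−4)+8)/2) v'' + (n²(n−4)²/16) v = (n(n−4)(n²−4)/16) v^{(n+4)/(n−4)}` at `t`. -/
def DelaunayODE (n : ℕ) (v : ℝ → ℝ) (t : ℝ) : Prop :=
  iteratedDeriv 4 v t - (((n : ℝ) * ((n : ℝ) - 4) + 8)/2) * iteratedDeriv 2 v t
      + ((n : ℝ)^2 * ((n : ℝ) - 4)^2/16) * v t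
    = ((n : ℝ) * ((n : ℝ) - 4) * ((n : ℝ)^2 - 4)/16) * v t ^ (((n : ℝ) + 4)/((n : ℝ) - 4))

theorem ContDiffAt.hasDerivAt_iteratedDeriv {𝕜 F : Type*} [NontriviallyNormedField 𝕜]
    [NormedAddCommGroup F] [NormedSpace 𝕜 F] {f : 𝕜 → F} {x : 𝕜} {n : WithTop ℕ∞} {m : ℕ}
    (h : ContDiffAt 𝕜 n f x) (hmn : m < n) :
    HasDerivAt (iteratedDeriv m f) (iteratedDeriv (m + 1) f x) x := by
  rw [iteratedDeriv_succ, hasDerivAt_deriv_iff, iteratedDeriv_eq_equiv_comp,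
    LinearIsometryEquiv.comp_differentiableAt_iff]
  exact h.differentiableAt_iteratedFDeriv hmn

theorem hasDerivAt_redHam {n : ℕ} (hn : 5 ≤ n) {v : ℝ → ℝ} {t : ℝ} (hpos : 0 < v t)
    (hreg : ContDiffAt ℝ 4 v t) (hode : DelaunayODE n v t) :
    HasDerivAt (redHam n v) 0 t := by
  have h0 : HasDerivAt v (deriv v t) t := by
    simpa using hreg.hasDerivAt_iteratedDeriv (m := 0) (by norm_num)
  have h1 : HasDerivAt (deriv v) (iteratedDeriv 2 v t) t := by
    simpa using hreg.hasDerivAt_iteratedDeriv (m := 1) (by norm_num)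
  have h2 : HasDerivAt (iteratedDeriv 2 v) (iteratedDeriv 3 v t) t :=
    hreg.hasDerivAt_iteratedDeriv (by norm_num)
  have h3 : HasDerivAt (iteratedDeriv 3 v) (iteratedDeriv 4 v t) t :=
    hreg.hasDerivAt_iteratedDeriv (by norm_num)
  have hn4 : (n : ℝ) - 4 ≠ 0 := by
    have : (5 : ℝ) ≤ n := by exact_mod_cast hn
    linarith
  have hexp : 2 * (n : ℝ) / (n - 4) - 1 = (n + 4) / (n - 4) := by
    field_simp
    ring
  have hcoef : ((n : ℝ) - 4) * (2 * n / (n - 4)) = 2 * n := by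
    field_simp
  have hpow := h0.rpow_const (p := 2 * (n : ℝ) / (n - 4)) (Or.inl hpos.ne')
  rw [hexp] at hpow
  have hderiv := ((((h1.neg.mul h3).add ((h2.pow 2).const_mul (1 / 2))).add
    ((h1.pow 2).const_mul (((n : ℝ) * (n - 4) + 8) / 4))).sub
    ((h0.pow 2).const_mul ((n : ℝ) ^ 2 * (n - 4) ^ 2 / 32))).add
    (hpow.const_mul (((n : ℝ) - 4) ^ 2 * (n ^ 2 - 4) / 32))
  refine hderiv.congr_deriv ?_
  unfold DelaunayODE at hode
  simp only [Pi.neg_apply]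
  push_cast
  linear_combination (-deriv v t) * hode + ((n : ℝ) - 4) * (n ^ 2 - 4) / 32 * deriv v t *
    v t ^ (((n : ℝ) + 4) / (n - 4)) * hcoef

/-- the reduced Hamiltonian is constant along C⁴ positive solutions of the
Delaunay ODE on an open interval `(a,b)`. -/
theorem redHam_constant_of_delaunay (n : ℕ) (hn : 5 ≤ n) (a b : ℝ) (v : ℝ → ℝ)
    (hpos : ∀ t ∈ Set.Ioo a b, 0 < v t)
    (hreg : ContDiffOn ℝ 4 v (Set.Ioo a b))
    (hode : ∀ t ∈ Set.Ioo a b, DelaunayODE n v t) :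
    ∀ t₁ ∈ Set.Ioo a b, ∀ t₂ ∈ Set.Ioo a b, redHam n v t₁ = redHam n v t₂ := by
  intro t₁ ht₁ t₂ ht₂
  have hderiv : ∀ t ∈ Set.Ioo a b, HasDerivAt (redHam n v) 0 t := fun t ht ↦
    hasDerivAt_redHam hn (hpos t ht) (hreg.contDiffAt (isOpen_Ioo.mem_nhds ht)) (hode t ht)
  exact isOpen_Ioo.is_const_of_deriv_eq_zero isPreconnected_Ioo
    (fun t ht ↦ (hderiv t ht).differentiableAt.differentiableWithinAt)
    (fun t ht ↦ (hderiv t ht).deriv) ht₁ ht₂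
end

section
/- Let n ≥ 5 be an integer, let A ∈ ℝ, and let v : (a,b) → (0,∞) be a C⁴ function satisfying v''''(t) − ((n(n−4)+8)/2) v''(t) + (n²(n−4)²/16) v(t) = A v(t)^{(n+4)/(n−4)} on (a,b). Then the quantity −v'(t)v'''(t) + (1/2)(v''(t))² + ((n(n−4)+8)/4)(v'(t))² − (n²(n−4)²/32) v(t)² + ((n−4)/(2n)) A v(t)^{2n/(n−4)} does not depend on t ∈ (a,b). -/
/-- The conserved quantity for solutions of `P_cyl v = A v^{(n+4)/(n−4)}` in the radial case:
`−v'v''' + (1/2)(v'')² + ((n(n−4)+8)/4)(v')² − (n²(n−4)²/32) v² + ((n−4)/(2n)) A v^{2n/(n−4)}`. -/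
noncomputable def pohoQty (n : ℕ) (A : ℝ) (v : ℝ → ℝ) (t : ℝ) : ℝ :=
  -(deriv v t) * iteratedDeriv 3 v t + (1/2) * (iteratedDeriv 2 v t)^2
    + (((n : ℝ) * ((n : ℝ) - 4) + 8)/4) * (deriv v t)^2
    - ((n : ℝ)^2 * ((n : ℝ) - 4)^2/32) * (v t)^2
    + (((n : ℝ) - 4)/(2 * (n : ℝ))) * A * v t ^ ((2 * (n : ℝ))/((n : ℝ) - 4))

theorem ContDiffAt.hasDerivAt_iteratedDeriv_s1 {v : ℝ → ℝ} {t : ℝ} {m : WithTop ℕ∞} {k : ℕ}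
    (h : ContDiffAt ℝ m v t) (hk : (k : WithTop ℕ∞) < m) :
    HasDerivAt (iteratedDeriv k v) (iteratedDeriv (k + 1) v t) t := by
  rw [iteratedDeriv_succ, hasDerivAt_deriv_iff, iteratedDeriv_eq_equiv_comp]
  exact (LinearIsometryEquiv.differentiable _).differentiableAt.comp t
    (h.differentiableAt_iteratedFDeriv hk)

/-- The derivative of `pohoQty` is `-v'` times the defect of the differential equation. -/
theorem hasDerivAt_pohoQty {n : ℕ} (hn : 5 ≤ n) (A : ℝ) {v : ℝ → ℝ} {t : ℝ}
    (hpos : 0 < v t) (h : ContDiffAt ℝ 4 v t) :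
    HasDerivAt (pohoQty n A v)
      (-deriv v t * (iteratedDeriv 4 v t
        - (((n : ℝ) * ((n : ℝ) - 4) + 8)/2) * iteratedDeriv 2 v t
        + ((n : ℝ)^2 * ((n : ℝ) - 4)^2/16) * v t
        - A * v t ^ (((n : ℝ) + 4)/((n : ℝ) - 4)))) t := by
  have hn' : (5 : ℝ) ≤ n := by exact_mod_cast hn
  have hn0 : (n : ℝ) ≠ 0 := by linarith
  have hn4 : (n : ℝ) - 4 ≠ 0 := by linarith
  have h0 : HasDerivAt v (deriv v t) t :=
    (h.differentiableAt (by norm_num)).hasDerivAt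
  have h1 : HasDerivAt (deriv v) (iteratedDeriv 2 v t) t := by
    simpa using h.hasDerivAt_iteratedDeriv_s1 (k := 1) (by norm_num)
  have h2 : HasDerivAt (iteratedDeriv 2 v) (iteratedDeriv 3 v t) t :=
    h.hasDerivAt_iteratedDeriv_s1 (by norm_num)
  have h3 : HasDerivAt (iteratedDeriv 3 v) (iteratedDeriv 4 v t) t :=
    h.hasDerivAt_iteratedDeriv_s1 (by norm_num)
  have hexp : 2 * (n : ℝ) / ((n : ℝ) - 4) - 1 = ((n : ℝ) + 4) / ((n : ℝ) - 4) := by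
    field_simp
    ring
  have hp := h0.rpow_const (p := 2 * (n : ℝ) / ((n : ℝ) - 4)) (Or.inl hpos.ne')
  rw [hexp] at hp
  refine HasDerivAt.congr_deriv (f := pohoQty n A v) (((((h1.neg.mul h3).add ((h2.pow 2).const_mul (1 / 2))).add
    ((h1.pow 2).const_mul (((n : ℝ) * ((n : ℝ) - 4) + 8) / 4))).sub
    ((h0.pow 2).const_mul ((n : ℝ)^2 * ((n : ℝ) - 4)^2 / 32))).add
    (hp.const_mul (((n : ℝ) - 4) / (2 * (n : ℝ)) * A))) ?_
  simp only [Pi.neg_apply]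
  field_simp
  ring

/-- for a C⁴ positive solution of
`v'''' − ((n(n−4)+8)/2) v'' + (n²(n−4)²/16) v = A v^{(n+4)/(n−4)}` on `(a,b)`, the
quantity `pohoQty` does not depend on `t`. -/
theorem pohoQty_constant (n : ℕ) (hn : 5 ≤ n) (A : ℝ) (a b : ℝ) (v : ℝ → ℝ)
    (hpos : ∀ t ∈ Set.Ioo a b, 0 < v t)
    (hreg : ContDiffOn ℝ 4 v (Set.Ioo a b))
    (hode : ∀ t ∈ Set.Ioo a b,
      iteratedDeriv 4 v t - (((n : ℝ) * ((n : ℝ) - 4) + 8)/2) * iteratedDeriv 2 v t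
          + ((n : ℝ)^2 * ((n : ℝ) - 4)^2/16) * v t
        = A * v t ^ (((n : ℝ) + 4)/((n : ℝ) - 4))) :
    ∀ t₁ ∈ Set.Ioo a b, ∀ t₂ ∈ Set.Ioo a b, pohoQty n A v t₁ = pohoQty n A v t₂ := by
  have hderiv : ∀ t ∈ Set.Ioo a b, HasDerivAt (pohoQty n A v) 0 t := by
    intro t ht
    have h := hasDerivAt_pohoQty hn A (hpos t ht) (hreg.contDiffAt (isOpen_Ioo.mem_nhds ht))
    rwa [hode t ht, sub_self, mul_zero] at h
  intro t₁ ht₁ t₂ ht₂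
  exact isOpen_Ioo.is_const_of_deriv_eq_zero isPreconnected_Ioo
    (fun t ht => (hderiv t ht).differentiableAt.differentiableWithinAt)
    (fun t ht => (hderiv t ht).deriv) ht₁ ht₂
end

section
/- Let n ≥ 5 be an integer and define v_sph : ℝ → (0,∞) by v_sph(t) = (cosh t)^{(4−n)/2}. Then for every t ∈ ℝ the reduced Hamiltonian vanishes: −v_sph'(t)v_sph'''(t) + (1/2)(v_sph''(t))² + ((n(n−4)+8)/4)(v_sph'(t))² − (n²(n−4)²/32) v_sph(t)² + ((n−4)²(n²−4)/32) v_sph(t)^{2n/(n−4)} = 0. -/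
open Real in
theorem hasDerivAt_cosh_rpow (a t : ℝ) :
    HasDerivAt (fun s => cosh s ^ a) (a * cosh t ^ (a - 1) * sinh t) t := by
  convert (hasDerivAt_cosh t).rpow_const (p := a) (Or.inl (cosh_pos t).ne') using 1
  ring

open Real in
theorem deriv_cosh_rpow (a : ℝ) :
    deriv (fun s => cosh s ^ a) = fun t => a * cosh t ^ (a - 1) * sinh t :=
  funext fun t => (hasDerivAt_cosh_rpow a t).deriv

open Real in
theorem iteratedDeriv_two_cosh_rpow (a : ℝ) :
    iteratedDeriv 2 (fun s => cosh s ^ a) =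
      fun t => a ^ 2 * cosh t ^ a - a * (a - 1) * cosh t ^ (a - 2) := by
  funext t
  rw [iteratedDeriv_succ, iteratedDeriv_one, deriv_cosh_rpow,
    (((hasDerivAt_cosh_rpow (a - 1) t).const_mul a).fun_mul (hasDerivAt_sinh t)).deriv,
    sub_sub, one_add_one_eq_two, rpow_sub_one (cosh_pos t).ne', rpow_sub (cosh_pos t), rpow_two]
  have := (cosh_pos t).ne'
  field_simp
  linear_combination a * (1 - a) * cosh_sq t

open Real in
theorem iteratedDeriv_three_cosh_rpow (a : ℝ) :
    iteratedDeriv 3 (fun s => cosh s ^ a) =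
      fun t => a ^ 3 * cosh t ^ (a - 1) * sinh t
        - a * (a - 1) * (a - 2) * cosh t ^ (a - 3) * sinh t := by
  funext t
  rw [iteratedDeriv_succ, iteratedDeriv_two_cosh_rpow,
    (((hasDerivAt_cosh_rpow a t).const_mul _).fun_sub
      ((hasDerivAt_cosh_rpow (a - 2) t).const_mul _)).deriv,
    sub_sub a, two_add_one_eq_three]
  ring

/-- the reduced Hamiltonian of the spherical solution
`v_sph(t) = (cosh t)^{(4−n)/2}` vanishes identically. -/
theorem redHam_sph_eq_zero (n : ℕ) (hn : 5 ≤ n) :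
    ∀ t : ℝ, redHam n (fun s => Real.cosh s ^ (((4 : ℝ) - (n : ℝ))/2)) t = 0 := by
  intro t
  have hn4 : (n : ℝ) - 4 ≠ 0 := by
    have : (5 : ℝ) ≤ n := by exact_mod_cast hn
    linarith
  have hc := Real.cosh_pos t
  obtain ⟨a, ha⟩ : ∃ a : ℝ, a = (4 - (n : ℝ)) / 2 := ⟨_, rfl⟩
  have hna : (n : ℝ) = 4 - 2 * a := by linarith
  have hexp : a * (2 * (n : ℝ) / (n - 4)) = a + a - (4 : ℕ) := by
    push_cast
    rw [ha]
    field_simp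
    ring
  rw [← ha, redHam, deriv_cosh_rpow, iteratedDeriv_two_cosh_rpow, iteratedDeriv_three_cosh_rpow]
  beta_reduce
  rw [← Real.rpow_mul hc.le, hexp, Real.rpow_sub hc (a + a), Real.rpow_add hc, Real.rpow_natCast,
    Real.rpow_sub_one hc.ne', Real.rpow_sub hc a 2, Real.rpow_two, Real.rpow_sub hc a 3,
    show (3 : ℝ) = (3 : ℕ) by norm_num, Real.rpow_natCast, hna]
  have := hc.ne'
  field_simp
  ring_nf
  simp only [Real.sinh_sq]
  ring
end

section
/- Let n ≥ 5 be an integer and define U_sph : ℝⁿ → (0,∞) by U_sph(x) = ((1+|x|²)/2)^{(4−n)/2}. Then U_sph is smooth and satisfies the bilaplacian equation Δ²U_sph(x) = (n(n−4)(n²−4)/16) U_sph(x)^{(n+4)/(n−4)} for all x ∈ ℝⁿ, where Δ is the Euclidean Laplacian. -/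
/-- The flat (Euclidean) Laplacian of `u : ℝⁿ → ℝ`, as the sum of pure second
partial derivatives in the coordinate directions. -/
noncomputable def lap {n : ℕ} (u : EuclideanSpace ℝ (Fin n) → ℝ)
    (x : EuclideanSpace ℝ (Fin n)) : ℝ :=
  ∑ i : Fin n, iteratedFDeriv ℝ 2 u x ![EuclideanSpace.single i 1, EuclideanSpace.single i 1]

lemma half_one_add_norm_sq_pos {E : Type*} [NormedAddCommGroup E] (x : E) :
    0 < (1 + ‖x‖ ^ 2) / 2 := by positivity

section RadialPower

variable {E : Type*} [NormedAddCommGroup E] [InnerProductSpace ℝ E]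

lemma contDiff_rpow_half_one_add_norm_sq (a : ℝ) {k : WithTop ℕ∞} :
    ContDiff ℝ k (fun x : E => ((1 + ‖x‖ ^ 2) / 2) ^ a) :=
  ((contDiff_const.add (contDiff_norm_sq ℝ)).div_const 2).rpow_const_of_ne
    fun x => (half_one_add_norm_sq_pos x).ne'

lemma hasFDerivAt_rpow_half_one_add_norm_sq (a : ℝ) (x : E) :
    HasFDerivAt (fun x : E => ((1 + ‖x‖ ^ 2) / 2) ^ a)
      ((a * ((1 + ‖x‖ ^ 2) / 2) ^ (a - 1)) • innerSL ℝ x) x := by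
  have h : HasFDerivAt (fun x : E => (1 + ‖x‖ ^ 2) / 2) (innerSL ℝ x) x := by
    have h1 := ((hasStrictFDerivAt_norm_sq x).hasFDerivAt.const_add 1).const_mul (2⁻¹ : ℝ)
    rw [two_smul, ← two_smul ℝ, inv_smul_smul₀ two_ne_zero] at h1
    simpa only [div_eq_inv_mul] using h1
  exact h.rpow_const (Or.inl (half_one_add_norm_sq_pos x).ne')

lemma iteratedFDeriv_two_rpow_half_one_add_norm_sq (a : ℝ) (x e : E) :
    iteratedFDeriv ℝ 2 (fun x : E => ((1 + ‖x‖ ^ 2) / 2) ^ a) x ![e, e] =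
      a * (a - 1) * ((1 + ‖x‖ ^ 2) / 2) ^ (a - 2) * inner ℝ x e ^ 2
        + a * ((1 + ‖x‖ ^ 2) / 2) ^ (a - 1) * ‖e‖ ^ 2 := by
  have h1 : fderiv ℝ (fun x : E => ((1 + ‖x‖ ^ 2) / 2) ^ a) =
      fun x => (a * ((1 + ‖x‖ ^ 2) / 2) ^ (a - 1)) • innerSL ℝ x :=
    funext fun y => (hasFDerivAt_rpow_half_one_add_norm_sq a y).fderiv
  have h2 := ((hasFDerivAt_rpow_half_one_add_norm_sq (a - 1) x).const_mul a).smul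
    (innerSL ℝ (E := E)).hasFDerivAt
  rw [iteratedFDeriv_two_apply, h1]
  erw [h2.fderiv]
  have h3 : a - 1 - 1 = a - 2 := by ring
  simp only [h3, innerSL_apply_apply, Matrix.cons_val_zero,
    Matrix.cons_val_one, add_apply, smul_apply,
    ContinuousLinearMap.smulRight_apply, smul_eq_mul]
  erw [innerSL_apply_apply, innerSL_apply_apply]
  rw [real_inner_self_eq_norm_sq]
  ring

end RadialPower

lemma lap_rpow_half_one_add_norm_sq {n : ℕ} (a : ℝ) (x : EuclideanSpace ℝ (Fin n)) :
    lap (fun y : EuclideanSpace ℝ (Fin n) => ((1 + ‖y‖ ^ 2) / 2) ^ a) x =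
      a * (n + 2 * (a - 1)) * ((1 + ‖x‖ ^ 2) / 2) ^ (a - 1)
        - a * (a - 1) * ((1 + ‖x‖ ^ 2) / 2) ^ (a - 2) := by
  have hw := half_one_add_norm_sq_pos x
  have hpow : ((1 + ‖x‖ ^ 2) / 2) ^ (a - 1) =
      ((1 + ‖x‖ ^ 2) / 2) ^ (a - 2) * ((1 + ‖x‖ ^ 2) / 2) := by
    rw [← Real.rpow_add_one hw.ne']
    ring_nf
  have hsum : ∑ i, x i ^ 2 = ‖x‖ ^ 2 := (EuclideanSpace.real_norm_sq_eq x).symm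
  simp only [lap, iteratedFDeriv_two_rpow_half_one_add_norm_sq, Finset.sum_add_distrib,
    ← Finset.mul_sum]
  simp only [EuclideanSpace.inner_single_right, PiLp.norm_single, norm_one,
    conj_trivial, one_mul, one_pow, Finset.sum_const, Finset.card_univ, Fintype.card_fin,
    nsmul_eq_mul, mul_one, hsum, hpow]
  ring

lemma lap_const_mul_sub_const_mul {n : ℕ} {f g : EuclideanSpace ℝ (Fin n) → ℝ}
    (hf : ContDiff ℝ 2 f) (hg : ContDiff ℝ 2 g) (c d : ℝ) (x : EuclideanSpace ℝ (Fin n)) :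
    lap (fun y => c * f y - d * g y) x = c * lap f x - d * lap g x := by
  have h : (fun y => c * f y - d * g y) = c • f - d • g := rfl
  simp only [lap, h, Finset.mul_sum, ← Finset.sum_sub_distrib]
  refine Finset.sum_congr rfl fun i _ => ?_
  rw [iteratedFDeriv_sub_apply (f := c • f) (g := d • g)
      (hf.const_smul c).contDiffAt (hg.const_smul d).contDiffAt,
    iteratedFDeriv_const_smul_apply hf.contDiffAt, iteratedFDeriv_const_smul_apply hg.contDiffAt]
  rfl

/-- `U_sph(x) = ((1+|x|²)/2)^{(4−n)/2}` is smooth and satisfies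
`Δ²U_sph = (n(n−4)(n²−4)/16) U_sph^{(n+4)/(n−4)}` on all of ℝⁿ. -/
theorem Usph_solves_bilaplacian (n : ℕ) (hn : 5 ≤ n) :
    ContDiff ℝ (⊤ : ℕ∞)
      (fun x : EuclideanSpace ℝ (Fin n) => ((1 + ‖x‖^2)/2) ^ (((4 : ℝ) - (n : ℝ))/2))
    ∧ (∀ x : EuclideanSpace ℝ (Fin n), 0 < ((1 + ‖x‖^2)/2) ^ (((4 : ℝ) - (n : ℝ))/2))
    ∧ ∀ x : EuclideanSpace ℝ (Fin n),
      lap (lap (fun y : EuclideanSpace ℝ (Fin n) =>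
          ((1 + ‖y‖^2)/2) ^ (((4 : ℝ) - (n : ℝ))/2))) x
        = ((n : ℝ) * ((n : ℝ) - 4) * ((n : ℝ)^2 - 4)/16)
            * (((1 + ‖x‖^2)/2) ^ (((4 : ℝ) - (n : ℝ))/2)) ^ (((n : ℝ) + 4)/((n : ℝ) - 4)) := by
  have hn' : (5 : ℝ) ≤ n := by exact_mod_cast hn
  refine ⟨contDiff_rpow_half_one_add_norm_sq _,
    fun x => Real.rpow_pos_of_pos (half_one_add_norm_sq_pos x) _, fun x => ?_⟩
  have hexp : ((4 : ℝ) - n) / 2 * ((n + 4) / (n - 4)) = (4 - n) / 2 - 2 - 2 := by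
    have : (n : ℝ) - 4 ≠ 0 := by linarith
    field_simp
    ring
  rw [← Real.rpow_mul (half_one_add_norm_sq_pos x).le, hexp,
    funext (lap_rpow_half_one_add_norm_sq (n := n) ((4 - n) / 2)),
    lap_const_mul_sub_const_mul (contDiff_rpow_half_one_add_norm_sq _)
      (contDiff_rpow_half_one_add_norm_sq _),
    lap_rpow_half_one_add_norm_sq, lap_rpow_half_one_add_norm_sq,
    show ((4 : ℝ) - n) / 2 - 1 - 2 = (4 - n) / 2 - 2 - 1 by ring]
  ring
end

section
/- Let n ≥ 5 be an integer and let w : ℝⁿ → (0,∞) be a smooth positive solution of Δ²w = (n(n−4)(n²−4)/16) w^{(n+4)/(n−4)} on all of ℝⁿ such that w(0) = sup_{ℝⁿ} w = 2^{(n−4)/2}. Then w(x) = ((1+|x|²)/2)^{(4−n)/2} for all x ∈ ℝⁿ. -/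
section Laplacian

open Set Filter Topology MeasureTheory Metric
open scoped ContDiff

variable {n : ℕ}

local notation "E" => EuclideanSpace ℝ (Fin n)

theorem lap_eq_sum_fderiv {u : E → ℝ} (hu : ContDiff ℝ ∞ u) (x : E) :
    lap u x = ∑ i : Fin n, fderiv ℝ (fun y => fderiv ℝ u y (EuclideanSpace.single i 1)) x
      (EuclideanSpace.single i 1) := by
  have hd : Differentiable ℝ (fderiv ℝ u) :=
    (hu.fderiv_right (m := ∞) le_rfl).differentiable (by simp)
  refine Finset.sum_congr rfl fun i _ => ?_
  rw [iteratedFDeriv_two_apply, fderiv_clm_apply (hd x) (differentiableAt_const _)]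
  simp

theorem contDiff_fderiv_apply_const {u : E → ℝ} (hu : ContDiff ℝ ∞ u) (e : E) :
    ContDiff ℝ ∞ (fun y => fderiv ℝ u y e) :=
  (hu.fderiv_right (m := ∞) le_rfl).clm_apply contDiff_const

theorem ContDiff.lap {u : E → ℝ} (hu : ContDiff ℝ ∞ u) : ContDiff ℝ ∞ (lap u) := by
  have : _root_.lap u = fun x => ∑ i : Fin n,
      fderiv ℝ (fun y => fderiv ℝ u y (EuclideanSpace.single i 1)) x
        (EuclideanSpace.single i 1) := funext (lap_eq_sum_fderiv hu)
  rw [this]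
  exact ContDiff.sum fun i _ => contDiff_fderiv_apply_const (contDiff_fderiv_apply_const hu _) _

theorem HasCompactSupport.lap {u : E → ℝ} (hc : HasCompactSupport u) :
    HasCompactSupport (lap u) := by
  refine (hc.iteratedFDeriv (𝕜 := ℝ) 2).mono fun x hx => ?_
  contrapose! hx
  simp only [Function.mem_support, not_not] at hx
  simp [_root_.lap, hx]

theorem lap_const_mul {u : E → ℝ} (hu : ContDiff ℝ ∞ u) (c : ℝ) (x : E) :
    lap (fun y => c * u y) x = c * lap u x := by
  rw [lap_eq_sum_fderiv (contDiff_const.mul hu), lap_eq_sum_fderiv hu, Finset.mul_sum]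
  refine Finset.sum_congr rfl fun i _ => ?_
  have : (fun y => fderiv ℝ (fun y => c * u y) y (EuclideanSpace.single i 1)) =
      fun y => c * fderiv ℝ u y (EuclideanSpace.single i 1) := by
    funext y
    rw [fderiv_const_mul (hu.differentiable (by simp) y)]
    rfl
  rw [this, fderiv_const_mul ((contDiff_fderiv_apply_const hu _).differentiable (by simp) _)]
  rfl

theorem integral_sum_fderiv_mul_fderiv {φ g : E → ℝ} (hφ : ContDiff ℝ ∞ φ)
    (hc : HasCompactSupport φ) (hg : ContDiff ℝ ∞ g) :
    ∫ z, ∑ i : Fin n, fderiv ℝ φ z (EuclideanSpace.single i 1) *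
      fderiv ℝ g z (EuclideanSpace.single i 1) = -∫ z, φ z * lap g z := by
  have hc' : ∀ e : E, HasCompactSupport fun z => fderiv ℝ φ z e := fun e => hc.fderiv_apply ℝ e
  have h1 : ∀ e : E, Continuous fun z => fderiv ℝ φ z e := fun e =>
    (contDiff_fderiv_apply_const hφ e).continuous
  have h2 : ∀ e : E, Continuous fun z => fderiv ℝ g z e := fun e =>
    (contDiff_fderiv_apply_const hg e).continuous
  have h3 : ∀ e : E, Continuous fun z => fderiv ℝ (fun y => fderiv ℝ g y e) z e := fun e =>
    (contDiff_fderiv_apply_const (contDiff_fderiv_apply_const hg e) e).continuous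
  rw [integral_finsetSum]
  · simp_rw [lap_eq_sum_fderiv hg, Finset.mul_sum]
    rw [integral_finsetSum, ← Finset.sum_neg_distrib]
    · refine Finset.sum_congr rfl fun i _ => ?_
      rw [eq_neg_iff_add_eq_zero, add_comm, ← eq_neg_iff_add_eq_zero]
      refine integral_mul_fderiv_eq_neg_fderiv_mul_of_integrable ?_ ?_ ?_ ?_ ?_
      · exact ((h1 _).mul (h2 _)).integrable_of_hasCompactSupport ((hc' _).mul_right)
      · exact (hφ.continuous.mul (h3 _)).integrable_of_hasCompactSupport hc.mul_right
      · exact (hφ.continuous.mul (h2 _)).integrable_of_hasCompactSupport hc.mul_right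
      · exact fun x _ => hφ.differentiable (by simp) x
      · exact fun x _ => (contDiff_fderiv_apply_const hg _).differentiable (by simp) x
    · exact fun i _ => (hφ.continuous.mul (h3 _)).integrable_of_hasCompactSupport hc.mul_right
  · exact fun i _ => ((h1 _).mul (h2 _)).integrable_of_hasCompactSupport ((hc' _).mul_right)

theorem integral_lap_mul {φ g : E → ℝ} (hφ : ContDiff ℝ ∞ φ)
    (hc : HasCompactSupport φ) (hg : ContDiff ℝ ∞ g) :
    ∫ z, lap φ z * g z = ∫ z, φ z * lap g z := by
  have hc' : ∀ e : E, HasCompactSupport fun z => fderiv ℝ φ z e := fun e => hc.fderiv_apply ℝ e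
  have h1 : ∀ e : E, Continuous fun z => fderiv ℝ φ z e := fun e =>
    (contDiff_fderiv_apply_const hφ e).continuous
  have h2 : ∀ e : E, Continuous fun z => fderiv ℝ g z e := fun e =>
    (contDiff_fderiv_apply_const hg e).continuous
  have h3 : ∀ e : E, Continuous fun z => fderiv ℝ (fun y => fderiv ℝ φ y e) z e := fun e =>
    (contDiff_fderiv_apply_const (contDiff_fderiv_apply_const hφ e) e).continuous
  have hc3 : ∀ e : E, HasCompactSupport fun z => fderiv ℝ (fun y => fderiv ℝ φ y e) z e :=
    fun e => (hc' e).fderiv_apply ℝ e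
  rw [← neg_inj, ← integral_sum_fderiv_mul_fderiv hφ hc hg, integral_finsetSum]
  · simp_rw [lap_eq_sum_fderiv hφ, Finset.sum_mul]
    rw [integral_finsetSum, ← Finset.sum_neg_distrib]
    · refine Finset.sum_congr rfl fun i _ => ?_
      symm
      refine integral_mul_fderiv_eq_neg_fderiv_mul_of_integrable ?_ ?_ ?_ ?_ ?_
      · exact ((h3 _).mul hg.continuous).integrable_of_hasCompactSupport ((hc3 _).mul_right)
      · exact ((h1 _).mul (h2 _)).integrable_of_hasCompactSupport ((hc' _).mul_right)
      · exact ((h1 _).mul hg.continuous).integrable_of_hasCompactSupport ((hc' _).mul_right)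
      · exact fun x _ => (contDiff_fderiv_apply_const hφ _).differentiable (by simp) x
      · exact fun x _ => hg.differentiable (by simp) x
    · exact fun i _ => ((h3 _).mul hg.continuous).integrable_of_hasCompactSupport
        ((hc3 _).mul_right)
  · exact fun i _ => ((h1 _).mul (h2 _)).integrable_of_hasCompactSupport ((hc' _).mul_right)

theorem fderiv_comp_add_smul {g : E → ℝ} (hg : Differentiable ℝ g) (x : E) (t : ℝ) (z e : E) :
    fderiv ℝ (fun z => g (x + t • z)) z e = t * fderiv ℝ g (x + t • z) e := by
  have h : HasFDerivAt (fun z : E => x + t • z) (t • ContinuousLinearMap.id ℝ E) z :=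
    ((hasFDerivAt_id z).const_smul t).const_add x
  have := (hg (x + t • z)).hasFDerivAt.comp z h
  rw [show (fun z => g (x + t • z)) = g ∘ fun z => x + t • z from rfl, this.fderiv]
  simp

theorem lap_comp_add_smul {g : E → ℝ} (hg : ContDiff ℝ ∞ g) (x : E) (t : ℝ) (z : E) :
    lap (fun z => g (x + t • z)) z = t ^ 2 * lap g (x + t • z) := by
  have hg' : ContDiff ℝ ∞ fun z => g (x + t • z) := hg.comp (by fun_prop)
  rw [lap_eq_sum_fderiv hg', lap_eq_sum_fderiv hg, Finset.mul_sum]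
  refine Finset.sum_congr rfl fun i _ => ?_
  have h1 : (fun y => fderiv ℝ (fun z => g (x + t • z)) y (EuclideanSpace.single i 1)) =
      fun y => t * fderiv ℝ g (x + t • y) (EuclideanSpace.single i 1) := by
    funext y
    exact fderiv_comp_add_smul (hg.differentiable (by simp)) x t y _
  have hd := (contDiff_fderiv_apply_const hg (EuclideanSpace.single i (1 : ℝ))).differentiable
    (by simp)
  rw [h1, fderiv_const_mul (by fun_prop)]
  simp only [smul_apply, smul_eq_mul]
  rw [fderiv_comp_add_smul hd]
  ring

theorem hasFDerivAt_comp_norm_sq {h : ℝ → ℝ} {h' : ℝ} {y : E} (hh : HasDerivAt h h' (‖y‖ ^ 2)) :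
    HasFDerivAt (fun y : E => h (‖y‖ ^ 2)) ((2 * h') • innerSL ℝ y) y := by
  have hc : HasFDerivAt (h ∘ fun x : E => ‖x‖ ^ 2) (h' • (2 : ℕ) • innerSL ℝ y) y :=
    hh.comp_hasFDerivAt y (hasStrictFDerivAt_norm_sq y).hasFDerivAt
  have he : h' • (2 : ℕ) • innerSL ℝ y = (2 * h') • innerSL ℝ y := by
    ext v
    simp
    ring
  exact he ▸ hc

theorem lap_comp_norm_sq {h h₁ h₂ : ℝ → ℝ} (H₁ : ∀ s, 0 ≤ s → HasDerivAt h (h₁ s) s)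
    (H₂ : ∀ s, 0 ≤ s → HasDerivAt h₁ (h₂ s) s) (x : E) :
    lap (fun y : E => h (‖y‖ ^ 2)) x =
      2 * n * h₁ (‖x‖ ^ 2) + 4 * ‖x‖ ^ 2 * h₂ (‖x‖ ^ 2) := by
  have hf : fderiv ℝ (fun y : E => h (‖y‖ ^ 2)) =
      fun y : E => (2 * h₁ (‖y‖ ^ 2)) • innerSL ℝ y :=
    funext fun y => (hasFDerivAt_comp_norm_sq (H₁ _ (sq_nonneg _))).fderiv
  let L : E →L[ℝ] E →L[ℝ] ℝ := LinearMap.toContinuousLinearMap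
    { toFun := fun y => innerSL ℝ y, map_add' := by simp, map_smul' := by simp }
  have hL : ∀ y z : E, L y z = inner ℝ y z := fun _ _ => rfl
  have hd : HasFDerivAt (fun y : E => (2 * h₁ (‖y‖ ^ 2)) • innerSL ℝ y)
      ((2 * h₁ (‖x‖ ^ 2)) • L +
        ((2 : ℝ) • ((2 * h₂ (‖x‖ ^ 2)) • innerSL ℝ x)).smulRight (L x)) x :=
    ((hasFDerivAt_comp_norm_sq (H₂ _ (sq_nonneg _))).const_mul 2).smul L.hasFDerivAt
  have hx : ‖x‖ ^ 2 = ∑ i, x i ^ 2 := by simp [EuclideanSpace.norm_sq_eq]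
  have hterm : ∀ i : Fin n, iteratedFDeriv ℝ 2 (fun y : E => h (‖y‖ ^ 2)) x
      ![EuclideanSpace.single i 1, EuclideanSpace.single i 1] =
      2 * h₁ (‖x‖ ^ 2) + 4 * h₂ (‖x‖ ^ 2) * x i ^ 2 := by
    intro i
    rw [iteratedFDeriv_two_apply, hf, hd.fderiv]
    simp [EuclideanSpace.inner_single_right, hL]
    ring
  simp_rw [lap, hterm, Finset.sum_add_distrib, ← Finset.mul_sum, ← hx]
  simp
  ring

end Laplacian

section RadialMeans

open Set Filter Topology MeasureTheory Metric
open scoped ContDiff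

variable {n : ℕ}

local notation "E" => EuclideanSpace ℝ (Fin n)

/-- The radial profile of the Laplacian of `z ↦ h (‖z‖ ^ 2)` on `ℝⁿ`. -/
noncomputable def lapProfile (n : ℕ) (h : ℝ → ℝ) (s : ℝ) : ℝ :=
  2 * n * deriv h s + 4 * s * deriv (deriv h) s

theorem contDiff_deriv {h : ℝ → ℝ} (hh : ContDiff ℝ ∞ h) : ContDiff ℝ ∞ (deriv h) :=
  ((contDiff_succ_iff_deriv (n := ∞)).1 (by simpa using hh)).2.2

theorem contDiff_lapProfile {h : ℝ → ℝ} (hh : ContDiff ℝ ∞ h) : ContDiff ℝ ∞ (lapProfile n h) := by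
  have h1 := contDiff_deriv hh
  have h2 := contDiff_deriv h1
  unfold lapProfile
  fun_prop

theorem hasCompactSupport_lapProfile {h : ℝ → ℝ} (hc : HasCompactSupport h) :
    HasCompactSupport (lapProfile n h) :=
  (hc.deriv.mul_left (f := fun _ => 2 * (n : ℝ))).add
    (hc.deriv.deriv.mul_left (f := fun s => 4 * s))

theorem hasCompactSupport_comp_norm_sq {h : ℝ → ℝ} (hc : HasCompactSupport h) :
    HasCompactSupport fun z : E => h (‖z‖ ^ 2) := by
  obtain ⟨R, hR⟩ := hc.isCompact.isBounded.subset_closedBall 0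
  refine HasCompactSupport.of_support_subset_isCompact (isCompact_closedBall (0 : E) (R + 1)) ?_
  intro z hz
  have := hR (subset_tsupport h hz)
  simp only [mem_closedBall, dist_zero_right, Real.norm_eq_abs, abs_pow, abs_norm] at this ⊢
  nlinarith [norm_nonneg z]

theorem lap_comp_norm_sq_eq_lapProfile {h : ℝ → ℝ} (hh : ContDiff ℝ ∞ h) :
    lap (fun z : E => h (‖z‖ ^ 2)) = fun z : E => lapProfile n h (‖z‖ ^ 2) :=
  funext fun z => lap_comp_norm_sq
    (fun s _ => (hh.differentiable (by simp) s).hasDerivAt)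
    (fun s _ => ((contDiff_deriv hh).differentiable (by simp) s).hasDerivAt) z

theorem contDiff_comp_norm_sq {h : ℝ → ℝ} (hh : ContDiff ℝ ∞ h) :
    ContDiff ℝ ∞ fun z : E => h (‖z‖ ^ 2) :=
  hh.comp (contDiff_norm_sq ℝ)

/-- The weight `ρ` with `∇ Δ (h (‖z‖ ^ 2)) = ρ z • z`. -/
noncomputable def gradWeight (n : ℕ) (h : ℝ → ℝ) (z : EuclideanSpace ℝ (Fin n)) : ℝ :=
  2 * deriv (lapProfile n h) (‖z‖ ^ 2)

theorem continuous_gradWeight {h : ℝ → ℝ} (hh : ContDiff ℝ ∞ h) :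
    Continuous (gradWeight n h) :=
  continuous_const.mul
    (contDiff_comp_norm_sq (contDiff_deriv (contDiff_lapProfile hh))).continuous

theorem hasCompactSupport_gradWeight {h : ℝ → ℝ} (hc : HasCompactSupport h) :
    HasCompactSupport (gradWeight n h) :=
  (hasCompactSupport_comp_norm_sq (hasCompactSupport_lapProfile (n := n) hc).deriv).mul_left
    (f := fun _ => (2 : ℝ))

theorem hasDerivAt_integral_mul_comp_add_smul {ρ w : E → ℝ} (hρ : Continuous ρ)
    (hc : HasCompactSupport ρ) (hw : ContDiff ℝ ∞ w) (x : E) (t : ℝ) :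
    HasDerivAt (fun t : ℝ => ∫ z, ρ z * w (x + t • z))
      (∫ z, ρ z * fderiv ℝ w (x + t • z) z) t := by
  have hw' : Continuous (fderiv ℝ w) := hw.continuous_fderiv (by simp)
  have hwc : Continuous w := hw.continuous
  have hcont : Continuous fun q : ℝ × E => ρ q.2 * fderiv ℝ w (x + q.1 • q.2) q.2 :=
    (hρ.comp continuous_snd).mul
      ((hw'.comp (by fun_prop)).clm_apply continuous_snd)
  obtain ⟨C, hC⟩ := ((isCompact_closedBall t 1).prod hc.isCompact).exists_bound_of_continuousOn
    hcont.continuousOn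
  refine (hasDerivAt_integral_of_dominated_loc_of_deriv_le (s := ball t 1)
    (F' := fun t z => ρ z * fderiv ℝ w (x + t • z) z)
    (bound := (tsupport ρ).indicator fun _ => C) (ball_mem_nhds t one_pos) ?_ ?_ ?_ ?_ ?_ ?_).2
  · exact .of_forall fun s => (hρ.mul (hwc.comp (by fun_prop))).aestronglyMeasurable
  · exact (hρ.mul (hwc.comp (by fun_prop))).integrable_of_hasCompactSupport hc.mul_right
  · exact (hρ.mul ((hw'.comp (by fun_prop)).clm_apply continuous_id)).aestronglyMeasurable
  · refine .of_forall fun z s hs => ?_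
    by_cases hz : z ∈ tsupport ρ
    · rw [indicator_of_mem hz]
      exact hC (s, z) ⟨ball_subset_closedBall hs, hz⟩
    · rw [indicator_of_notMem hz, image_eq_zero_of_notMem_tsupport hz]
      simp
  · rw [integrable_indicator_iff hc.isCompact.isClosed.measurableSet]
    exact integrableOn_const hc.isCompact.measure_lt_top.ne
  · refine .of_forall fun z s _ => HasDerivAt.const_mul _ ?_
    have h : HasDerivAt (fun t : ℝ => x + t • z) z s := by
      simpa using ((hasDerivAt_id s).smul_const z).const_add x
    exact (hw.differentiable (by simp) _).hasFDerivAt.comp_hasDerivAt s h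

theorem integral_gradWeight_mul_fderiv {h : ℝ → ℝ} (hh : ContDiff ℝ ∞ h)
    (hc : HasCompactSupport h) {w : E → ℝ} (hw : ContDiff ℝ ∞ w) (x : E) {t : ℝ} (ht : t ≠ 0) :
    ∫ z, gradWeight n h z * fderiv ℝ w (x + t • z) z =
      -(t ^ 3 * ∫ z, h (‖z‖ ^ 2) * lap (lap w) (x + t • z)) := by
  have hg : ContDiff ℝ ∞ fun z : E => w (x + t • z) := hw.comp (by fun_prop)
  have hk := contDiff_lapProfile (n := n) hh
  have hkc := hasCompactSupport_lapProfile (n := n) hc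
  have h1 := integral_sum_fderiv_mul_fderiv (contDiff_comp_norm_sq (n := n) hk)
    (hasCompactSupport_comp_norm_sq hkc) hg
  have h2 := integral_lap_mul (contDiff_comp_norm_sq (n := n) hh)
    (hasCompactSupport_comp_norm_sq hc) hg.lap
  rw [lap_comp_norm_sq_eq_lapProfile hh] at h2
  have e1 : lap (fun z : E => w (x + t • z)) = fun z => t ^ 2 * lap w (x + t • z) :=
    funext (lap_comp_add_smul hw x t)
  have e2 : lap (lap fun z : E => w (x + t • z)) =
      fun z => t ^ 4 * lap (lap w) (x + t • z) := by
    rw [e1]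
    funext z
    rw [lap_const_mul (u := fun z => lap w (x + t • z)) (hw.lap.comp (by fun_prop)),
      lap_comp_add_smul hw.lap]
    ring
  have e3 : ∀ z : E, ∑ i : Fin n, fderiv ℝ (fun z : E => lapProfile n h (‖z‖ ^ 2)) z
      (EuclideanSpace.single i 1) *
        fderiv ℝ (fun z => w (x + t • z)) z (EuclideanSpace.single i 1) =
      t * (gradWeight n h z * fderiv ℝ w (x + t • z) z) := by
    intro z
    have hz : fderiv ℝ w (x + t • z) z =
        ∑ i : Fin n, z i * fderiv ℝ w (x + t • z) (EuclideanSpace.single i 1) := by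
      generalize fderiv ℝ w (x + t • z) = L
      conv_lhs => rw [← (EuclideanSpace.basisFun (Fin n) ℝ).sum_repr z]
      simp
    rw [hz, Finset.mul_sum, Finset.mul_sum]
    refine Finset.sum_congr rfl fun i _ => ?_
    rw [fderiv_comp_add_smul (hw.differentiable (by simp)),
      (hasFDerivAt_comp_norm_sq (hk.differentiable (by simp) _).hasDerivAt).fderiv]
    simp [EuclideanSpace.inner_single_right, gradWeight]
    ring
  rw [integral_congr_ae (.of_forall e3), h2, e2, integral_const_mul] at h1
  have e4 : ∀ z : E, h (‖z‖ ^ 2) * (t ^ 4 * lap (lap w) (x + t • z)) =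
      t ^ 4 * (h (‖z‖ ^ 2) * lap (lap w) (x + t • z)) := fun z => by ring
  simp_rw [e4, integral_const_mul] at h1
  apply mul_left_cancel₀ ht
  rw [h1]
  ring

end RadialMeans

section BoundedBisubharmonic

open Set Filter Topology MeasureTheory Metric
open scoped ContDiff

variable {n : ℕ}

local notation "E" => EuclideanSpace ℝ (Fin n)

theorem exists_tendsto_of_hasDerivAt_nonpos {M D : ℝ → ℝ} (hD : ∀ t, HasDerivAt M (D t) t)
    (hneg : ∀ t, 0 < t → D t ≤ 0) {B : ℝ} (hB : ∀ t, B ≤ M t) :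
    ∃ l, Tendsto M atTop (𝓝 l) := by
  have hanti : AntitoneOn M (Ici 0) := by
    refine antitoneOn_of_deriv_nonpos (convex_Ici 0)
      (fun t _ => (hD t).continuousAt.continuousWithinAt)
      (fun t _ => (hD t).differentiableAt.differentiableWithinAt) fun t ht => ?_
    rw [interior_Ici] at ht
    rw [(hD t).deriv]
    exact hneg t ht
  have h : Antitone fun t : ℝ => M (max t 0) := fun s t hst =>
    hanti (mem_Ici.2 (le_max_right _ _)) (mem_Ici.2 (le_max_right _ _)) (max_le_max_right 0 hst)
  refine ⟨_, (tendsto_atTop_ciInf h ⟨B, ?_⟩).congr' ?_⟩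
  · rintro _ ⟨t, rfl⟩
    exact hB _
  · filter_upwards [eventually_ge_atTop (0 : ℝ)] with t ht
    rw [max_eq_left ht]

theorem exists_tendsto_radialMean {h : ℝ → ℝ} (hh : ContDiff ℝ ∞ h) (hc : HasCompactSupport h)
    (h0 : ∀ s, 0 ≤ h s) {w : E → ℝ} (hw : ContDiff ℝ ∞ w) {W : ℝ} (hW : ∀ x, |w x| ≤ W)
    (hf : ∀ x, 0 ≤ lap (lap w) x) (x : E) :
    ∃ l, Tendsto (fun t : ℝ => ∫ z, gradWeight n h z * w (x + t • z)) atTop (𝓝 l) ∧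
      IntegrableOn (fun t : ℝ => t ^ 3 * ∫ z, h (‖z‖ ^ 2) * lap (lap w) (x + t • z)) (Ioi 0) ∧
      ∫ t in Ioi (0 : ℝ), t ^ 3 * ∫ z, h (‖z‖ ^ 2) * lap (lap w) (x + t • z) =
        w x * (∫ z, gradWeight n h z) - l := by
  have hρ := continuous_gradWeight (n := n) hh
  have hρc := hasCompactSupport_gradWeight (n := n) hc
  have hD := hasDerivAt_integral_mul_comp_add_smul hρ hρc hw x
  have hm : ∀ t : ℝ, 0 ≤ ∫ z, h (‖z‖ ^ 2) * lap (lap w) (x + t • z) := fun t =>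
    integral_nonneg fun z => mul_nonneg (h0 _) (hf _)
  have hD' : ∀ t : ℝ, 0 < t → HasDerivAt (fun t : ℝ => ∫ z, gradWeight n h z * w (x + t • z))
      (-(t ^ 3 * ∫ z, h (‖z‖ ^ 2) * lap (lap w) (x + t • z))) t := fun t ht => by
    rw [← integral_gradWeight_mul_fderiv hh hc hw x ht.ne']
    exact hD t
  have hnp : ∀ t : ℝ, 0 < t → -(t ^ 3 * ∫ z, h (‖z‖ ^ 2) * lap (lap w) (x + t • z)) ≤ 0 :=
    fun t ht => neg_nonpos.2 (mul_nonneg (pow_nonneg ht.le 3) (hm t))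
  have hbound : ∀ t : ℝ, -(∫ z, |gradWeight n h z| * W) ≤
      ∫ z, gradWeight n h z * w (x + t • z) := by
    intro t
    refine neg_le_of_abs_le ((abs_integral_le_integral_abs).trans (integral_mono ?_ ?_ ?_))
    · exact ((hρ.mul (hw.continuous.comp (by fun_prop))).integrable_of_hasCompactSupport
        hρc.mul_right).abs
    · exact ((hρ.integrable_of_hasCompactSupport hρc).abs).mul_const W
    · intro z
      simp only [abs_mul]
      exact mul_le_mul_of_nonneg_left (hW _) (abs_nonneg _)
  obtain ⟨l, hl⟩ := exists_tendsto_of_hasDerivAt_nonpos hD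
    (fun t ht => (hD t).unique (hD' t ht) ▸ hnp t ht) hbound
  have hcont := (hD 0).continuousAt.continuousWithinAt (s := Ici (0 : ℝ))
  refine ⟨l, hl, ?_, ?_⟩
  · simpa using (integrableOn_Ioi_deriv_of_nonpos hcont hD' hnp hl).neg
  · have := integral_Ioi_of_hasDerivAt_of_nonpos hcont hD' hnp hl
    rw [integral_neg] at this
    simp only [zero_smul, add_zero, integral_mul_const] at this
    linarith

theorem frequently_lt_of_integrableOn_pow_mul {m : ℝ → ℝ} (hm : ∀ t, 0 ≤ m t)
    (hi : IntegrableOn (fun t => t ^ 3 * m t) (Ioi 0)) {ε : ℝ} (hε : 0 < ε) :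
    ∃ᶠ t in atTop, m t < ε := by
  intro hcon
  obtain ⟨T, hT⟩ := eventually_atTop.1 hcon
  have hsub : Ioi (max T 1) ⊆ Ioi (0 : ℝ) :=
    Ioi_subset_Ioi (zero_le_one.trans (le_max_right _ _))
  have : IntegrableOn (fun _ : ℝ => ε) (Ioi (max T 1)) := by
    refine Integrable.mono' (hi.mono_set hsub) aestronglyMeasurable_const ?_
    refine (ae_restrict_iff' measurableSet_Ioi).2 (.of_forall fun t ht => ?_)
    have h1 : 1 < t := (le_max_right _ _).trans_lt ht
    have h2 : ε ≤ m t := not_lt.1 (hT t ((le_max_left _ _).trans ht.le))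
    rw [Real.norm_of_nonneg hε.le]
    have h3 : 1 ≤ t ^ 3 := one_le_pow₀ h1.le
    exact h2.trans (le_mul_of_one_le_left (hm t) h3)
  rw [integrableOn_const_iff] at this
  simp [hε.ne'] at this

theorem exists_smooth_cutoff (R : ℝ) : ∃ h : ℝ → ℝ, ContDiff ℝ ∞ h ∧ HasCompactSupport h ∧
    (∀ s, 0 ≤ h s) ∧ ∀ s, |s| ≤ R → h s = 1 := by
  let b : ContDiffBump (0 : ℝ) := ⟨|R| + 1, |R| + 2, by positivity, by linarith⟩
  refine ⟨b, b.contDiff, b.hasCompactSupport, fun s => b.nonneg, fun s hs => ?_⟩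
  refine b.one_of_mem_closedBall ?_
  simp only [b, mem_closedBall, dist_zero_right, Real.norm_eq_abs]
  linarith [le_abs_self R]

theorem le_add_rpow_mul_rpow {a δ p : ℝ} (ha : 0 < a) (hδ : 0 < δ) (hp : 1 ≤ p) :
    a ≤ δ + δ ^ (1 - p) * a ^ p := by
  rcases le_total a δ with h | h
  · exact h.trans (le_add_of_nonneg_right (by positivity))
  · have h1 : a ^ (1 - p) ≤ δ ^ (1 - p) := Real.rpow_le_rpow_of_nonpos hδ h (by linarith)
    have h2 : a ^ (1 - p) * a ^ p = a := by
      rw [← Real.rpow_add ha]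
      simp
    nlinarith [mul_le_mul_of_nonneg_right h1 (Real.rpow_nonneg ha.le p)]

theorem integral_pow_mul_eq {h : ℝ → ℝ} (hh : ContDiff ℝ ∞ h) (hc : HasCompactSupport h)
    (h0 : ∀ s, 0 ≤ h s) {w : E → ℝ} (hw : ContDiff ℝ ∞ w) (hpos : ∀ x, 0 < w x) {W : ℝ}
    (hW : ∀ x, w x ≤ W) {κ p : ℝ} (hκ : 0 < κ) (hp : 1 ≤ p)
    (hf : ∀ x, lap (lap w) x = κ * w x ^ p) (x : E) :
    IntegrableOn (fun t : ℝ => t ^ 3 * ∫ z, h (‖z‖ ^ 2) * lap (lap w) (x + t • z)) (Ioi 0) ∧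
      ∫ t in Ioi (0 : ℝ), t ^ 3 * ∫ z, h (‖z‖ ^ 2) * lap (lap w) (x + t • z) =
        w x * ∫ z, gradWeight n h z := by
  have hρ := continuous_gradWeight (n := n) hh
  have hρc := hasCompactSupport_gradWeight (n := n) hc
  have hW' : ∀ x, |w x| ≤ W := fun x => by rw [abs_of_pos (hpos x)]; exact hW x
  have hf0 : ∀ x, 0 ≤ lap (lap w) x := fun x => by
    rw [hf]
    exact mul_nonneg hκ.le (Real.rpow_nonneg (hpos x).le _)
  obtain ⟨l, hl, h_int, heq⟩ := exists_tendsto_radialMean hh hc h0 hw hW' hf0 x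
  suffices l = 0 by
    subst this
    exact ⟨h_int, by rw [heq, sub_zero]⟩
  obtain ⟨R, hR⟩ := hρc.isCompact.isBounded.subset_closedBall 0
  obtain ⟨h₁, hh₁, hc₁, h₁0, h₁1⟩ := exists_smooth_cutoff (R ^ 2)
  obtain ⟨-, -, hint₁, -⟩ := exists_tendsto_radialMean hh₁ hc₁ h₁0 hw hW' hf0 x
  have hm₁ : ∀ t : ℝ, 0 ≤ ∫ z, h₁ (‖z‖ ^ 2) * lap (lap w) (x + t • z) := fun t =>
    integral_nonneg fun z => mul_nonneg (h₁0 _) (hf0 _)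
  obtain ⟨C, hC⟩ := hρ.bounded_above_of_compact_support hρc
  have hC0 : 0 ≤ C := (norm_nonneg _).trans (hC 0)
  set I := ∫ z, |gradWeight n h z|
  have hI : 0 ≤ I := integral_nonneg fun z => abs_nonneg _
  have hlap : Continuous (lap (lap w)) := hw.lap.lap.continuous
  have key : ∀ δ : ℝ, 0 < δ → ∀ t : ℝ, |∫ z, gradWeight n h z * w (x + t • z)| ≤
      δ * I + C * δ ^ (1 - p) / κ * ∫ z, h₁ (‖z‖ ^ 2) * lap (lap w) (x + t • z) := by
    intro δ hδ t
    have i1 : Integrable fun z : E => δ * |gradWeight n h z| :=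
      ((hρ.integrable_of_hasCompactSupport hρc).abs).const_mul δ
    have i2 : Integrable fun z : E => C * δ ^ (1 - p) / κ *
        (h₁ (‖z‖ ^ 2) * lap (lap w) (x + t • z)) :=
      (((contDiff_comp_norm_sq hh₁).continuous.mul
        (hlap.comp (by fun_prop))).integrable_of_hasCompactSupport
          (hasCompactSupport_comp_norm_sq hc₁).mul_right).const_mul _
    rw [← integral_const_mul, ← integral_const_mul, ← integral_add i1 i2]
    refine abs_integral_le_integral_abs.trans (integral_mono ?_ (i1.add i2) fun z => ?_)
    · exact ((hρ.mul (hw.continuous.comp (by fun_prop))).integrable_of_hasCompactSupport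
        hρc.mul_right).abs
    · simp only [abs_mul, abs_of_pos (hpos _), hf]
      have h1 := le_add_rpow_mul_rpow (hpos (x + t • z)) hδ hp
      have h2 : |gradWeight n h z| ≤ C * h₁ (‖z‖ ^ 2) := by
        by_cases hz : z ∈ tsupport (gradWeight n h)
        · have hz' : ‖z‖ ≤ R := by simpa using hR hz
          rw [h₁1, mul_one]
          · exact hC z
          · rw [abs_of_nonneg (sq_nonneg _)]
            exact pow_le_pow_left₀ (norm_nonneg _) hz' 2
        · rw [image_eq_zero_of_notMem_tsupport hz, abs_zero]
          exact mul_nonneg hC0 (h₁0 _)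
      have h3 : 0 ≤ δ ^ (1 - p) * w (x + t • z) ^ p :=
        mul_nonneg (Real.rpow_nonneg hδ.le _) (Real.rpow_nonneg (hpos _).le _)
      calc |gradWeight n h z| * w (x + t • z)
          ≤ |gradWeight n h z| * (δ + δ ^ (1 - p) * w (x + t • z) ^ p) :=
            mul_le_mul_of_nonneg_left h1 (abs_nonneg _)
        _ ≤ δ * |gradWeight n h z| +
            (C * h₁ (‖z‖ ^ 2)) * (δ ^ (1 - p) * w (x + t • z) ^ p) := by
            rw [mul_add, mul_comm _ δ]
            gcongr
        _ = _ := by field_simp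
  have hlabs := hl.abs
  have hsmall : ∀ ε : ℝ, 0 < ε → |l| ≤ ε := by
    intro ε hε
    have hδ : 0 < ε / (4 * (I + 1)) := by positivity
    set δ := ε / (4 * (I + 1)) with hδdef
    have hδI : δ * I ≤ ε / 4 := by
      rw [hδdef, div_mul_eq_mul_div, div_le_div_iff₀ (by positivity) (by positivity)]
      nlinarith
    set K := C * δ ^ (1 - p) / κ
    have hK : 0 ≤ K := by positivity
    have hfr := frequently_lt_of_integrableOn_pow_mul hm₁ hint₁
      (show 0 < ε / (4 * (K + 1)) by positivity)
    obtain ⟨t, ht, ht'⟩ := (hfr.and_eventually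
      (hlabs.eventually (lt_mem_nhds (show |l| - ε / 4 < |l| by linarith)))).exists
    have h1 := key δ hδ t
    have h2 : K * (ε / (4 * (K + 1))) ≤ ε / 4 := by
      rw [← mul_div_assoc, div_le_div_iff₀ (by positivity) (by positivity)]
      nlinarith
    have h3 := mul_le_mul_of_nonneg_left ht.le hK
    linarith
  exact abs_eq_zero.1 (le_antisymm (le_of_forall_pos_le_add fun ε hε => by
    simpa using hsmall ε hε) (abs_nonneg l))

end BoundedBisubharmonic

section Representation

open Set Filter Topology MeasureTheory Metric
open scoped ContDiff ENNReal

variable {n : ℕ}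

local notation "E" => EuclideanSpace ℝ (Fin n)

theorem lintegral_radial_scaling {m : ℕ} (hn : n = m + 4) (h : ℝ → ℝ) {r : ℝ} (hr : 0 < r) :
    ∫⁻ t in Ioi (0 : ℝ), ENNReal.ofReal (t ^ 3 * (t ^ n)⁻¹ * h (r ^ 2 / t ^ 2)) =
      ENNReal.ofReal (r ^ m)⁻¹ *
        ∫⁻ s in Ioi (0 : ℝ), ENNReal.ofReal (s ^ 3 * (s ^ n)⁻¹ * h (1 / s ^ 2)) := by
  have himg : (fun s : ℝ => r * s) '' Ioi 0 = Ioi 0 := by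
    rw [image_mul_left_Ioi hr, mul_zero]
  rw [← lintegral_const_mul' _ _ ENNReal.ofReal_ne_top]
  conv_lhs => rw [← himg]
  rw [lintegral_image_eq_lintegral_abs_deriv_mul measurableSet_Ioi
    (f' := fun _ => r) (fun s _ => by
      simpa using ((hasDerivAt_id s).const_mul r).hasDerivWithinAt)
    (fun a _ b _ hab => mul_left_cancel₀ hr.ne' hab)]
  refine setLIntegral_congr_fun measurableSet_Ioi fun s hs => ?_
  have hs : 0 < s := hs
  rw [← ENNReal.ofReal_mul (abs_nonneg _), ← ENNReal.ofReal_mul (by positivity), abs_of_pos hr]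
  congr 1
  have h1 : r ^ 2 / (r * s) ^ 2 = 1 / s ^ 2 := by field_simp
  rw [h1]
  subst hn
  field_simp
  ring

theorem integral_comp_norm_sq_smul (h : ℝ → ℝ) (f : E → ℝ) (x : E) {t : ℝ} (ht : 0 < t) :
    ∫ z : E, h (‖z‖ ^ 2) * f (x + t • z) =
      (t ^ n)⁻¹ * ∫ y : E, h (‖y‖ ^ 2 / t ^ 2) * f (x + y) := by
  have := Measure.integral_comp_smul_of_nonneg (volume : Measure E)
    (fun y : E => h (‖y‖ ^ 2 / t ^ 2) * f (x + y)) t (hR := ht.le)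
  rw [finrank_euclideanSpace_fin, smul_eq_mul] at this
  rw [← this]
  refine integral_congr_ae (.of_forall fun z => ?_)
  simp only
  rw [norm_smul, Real.norm_of_nonneg ht.le]
  congr 2
  field_simp

theorem ofReal_integral_radialMean {m : ℕ} (hn : n = m + 4) {h : ℝ → ℝ} (hh : Continuous h)
    (hc : HasCompactSupport h) (h0 : ∀ s, 0 ≤ h s) {f : E → ℝ} (hf : Continuous f)
    (hf0 : ∀ x, 0 ≤ f x) (x : E)
    (h_int : IntegrableOn (fun t : ℝ => t ^ 3 * ∫ z, h (‖z‖ ^ 2) * f (x + t • z)) (Ioi 0)) :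
    ENNReal.ofReal (∫ t in Ioi (0 : ℝ), t ^ 3 * ∫ z, h (‖z‖ ^ 2) * f (x + t • z)) =
      (∫⁻ y, ENNReal.ofReal ((‖y‖ ^ m)⁻¹ * f (x + y))) *
        ∫⁻ s in Ioi (0 : ℝ), ENNReal.ofReal (s ^ 3 * (s ^ n)⁻¹ * h (1 / s ^ 2)) := by
  have hm : ∀ t : ℝ, 0 ≤ ∫ z : E, h (‖z‖ ^ 2) * f (x + t • z) := fun t =>
    integral_nonneg fun z => mul_nonneg (h0 _) (hf0 _)
  rw [ofReal_integral_eq_lintegral_ofReal h_int ((ae_restrict_iff' measurableSet_Ioi).2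
    (.of_forall fun t ht => mul_nonneg (pow_nonneg (le_of_lt ht) 3) (hm t)))]
  have hmeas : Measurable fun q : ℝ × E =>
      ENNReal.ofReal (q.1 ^ 3 * (q.1 ^ n)⁻¹ * h (‖q.2‖ ^ 2 / q.1 ^ 2) * f (x + q.2)) := by
    have h1 := hh.measurable
    have h2 := hf.measurable
    fun_prop
  have hstep : ∀ t ∈ Ioi (0 : ℝ),
      ENNReal.ofReal (t ^ 3 * ∫ z, h (‖z‖ ^ 2) * f (x + t • z)) =
      ∫⁻ y, ENNReal.ofReal (t ^ 3 * (t ^ n)⁻¹ * h (‖y‖ ^ 2 / t ^ 2) * f (x + y)) := by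
    intro t ht
    have ht : 0 < t := ht
    rw [integral_comp_norm_sq_smul h f x ht, ← mul_assoc, ← integral_const_mul]
    have hcs : HasCompactSupport fun y : E => h (‖y‖ ^ 2 / t ^ 2) := by
      obtain ⟨R, hR⟩ := hc.isCompact.isBounded.subset_closedBall 0
      refine HasCompactSupport.of_support_subset_isCompact
        (isCompact_closedBall (0 : E) (t * (|R| + 1))) fun y hy => ?_
      have h1 : ‖y‖ ^ 2 / t ^ 2 ∈ closedBall (0 : ℝ) R := hR (subset_tsupport _ hy)
      rw [mem_closedBall, dist_zero_right, Real.norm_of_nonneg (by positivity),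
        div_le_iff₀ (by positivity)] at h1
      rw [mem_closedBall, dist_zero_right]
      refine pow_le_pow_iff_left₀ (norm_nonneg y) (by positivity) two_ne_zero |>.1 ?_
      have h3 : R ≤ (|R| + 1) ^ 2 := by nlinarith [le_abs_self R, abs_nonneg R]
      calc ‖y‖ ^ 2 ≤ R * t ^ 2 := h1
        _ ≤ (|R| + 1) ^ 2 * t ^ 2 := by gcongr
        _ = _ := by ring
    rw [ofReal_integral_eq_lintegral_ofReal]
    · simp only [mul_assoc]
    · refine Integrable.const_mul (Continuous.integrable_of_hasCompactSupport ?_ ?_) _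
      · fun_prop
      · exact hcs.mul_right
    · exact .of_forall fun y => mul_nonneg (by positivity) (mul_nonneg (h0 _) (hf0 _))
  rw [setLIntegral_congr_fun measurableSet_Ioi hstep, lintegral_lintegral_swap hmeas.aemeasurable]
  rw [← lintegral_mul_const'']
  · have hnt : Nontrivial E := by
      subst hn
      exact inferInstance
    refine lintegral_congr_ae ?_
    filter_upwards [compl_mem_ae_iff.2 (measure_singleton (μ := (volume : Measure E)) 0)] with y hy
    have hy : 0 < ‖y‖ := norm_pos_iff.2 hy
    rw [ENNReal.ofReal_mul (by positivity), mul_right_comm,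
      ← lintegral_radial_scaling hn h hy, ← lintegral_mul_const' _ _ ENNReal.ofReal_ne_top]
    refine setLIntegral_congr_fun measurableSet_Ioi fun t ht => ?_
    have ht : 0 < t := ht
    exact ENNReal.ofReal_mul (mul_nonneg (by positivity) (h0 _))
  · have h2 := hf.measurable
    exact Measurable.aemeasurable (by fun_prop)

theorem exists_integral_representation {m : ℕ} (hn : n = m + 4) {w : E → ℝ}
    (hw : ContDiff ℝ ∞ w) (hpos : ∀ x, 0 < w x) {W : ℝ}
    (hW : ∀ x, w x ≤ W) {κ p : ℝ} (hκ : 0 < κ) (hp : 1 ≤ p)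
    (hf : ∀ x, lap (lap w) x = κ * w x ^ p) :
    ∃ C : ℝ, 0 < C ∧ ∀ x, Integrable (fun z => (dist x z ^ m)⁻¹ * w z ^ p) ∧
      w x = C * ∫ z, (dist x z ^ m)⁻¹ * w z ^ p := by
  obtain ⟨h, hh, hc, h0, h1⟩ := exists_smooth_cutoff 1
  have key := integral_pow_mul_eq hh hc h0 hw hpos hW hκ hp hf
  set I := ∫ z, gradWeight n h z
  set c := ∫⁻ s in Ioi (0 : ℝ), ENNReal.ofReal (s ^ 3 * (s ^ n)⁻¹ * h (1 / s ^ 2))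
  have hlap : Continuous (lap (lap w)) := hw.lap.lap.continuous
  have hlp : ∀ x, 0 < lap (lap w) x := fun x => by
    rw [hf]
    exact mul_pos hκ (Real.rpow_pos_of_pos (hpos x) _)
  have hI : 0 < I := by
    obtain ⟨h_int, heq⟩ := key 0
    have hm : ∀ t : ℝ, 0 < ∫ z : E, h (‖z‖ ^ 2) * lap (lap w) (0 + t • z) := fun t => by
      refine Continuous.integral_pos_of_hasCompactSupport_nonneg_nonzero (x := 0) ?_ ?_ ?_ ?_
      · have := hh.continuous
        fun_prop
      · exact (hasCompactSupport_comp_norm_sq hc).mul_right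
      · exact fun z => mul_nonneg (h0 _) (hlp _).le
      · simp [h1 0, (hlp 0).ne']
    have : 0 < w 0 * I := by
      rw [← heq, setIntegral_pos_iff_support_of_nonneg_ae]
      · refine lt_of_lt_of_le ?_ (measure_mono (s := Ioi (0 : ℝ)) fun t ht =>
          ⟨(mul_pos (pow_pos ht 3) (hm t)).ne', ht⟩)
        simp
      · exact (ae_restrict_iff' measurableSet_Ioi).2
          (.of_forall fun t ht => (mul_pos (pow_pos ht 3) (hm t)).le)
      · exact h_int
    exact pos_of_mul_pos_right this (hpos 0).le
  have hJ : ∀ x, ENNReal.ofReal (w x * I) =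
      (∫⁻ z, ENNReal.ofReal ((dist x z ^ m)⁻¹ * lap (lap w) z)) * c := fun x => by
    obtain ⟨h_int, heq⟩ := key x
    rw [← heq, ofReal_integral_radialMean hn hh.continuous hc h0 hlap (fun x => (hlp x).le) x
      h_int]
    congr 1
    rw [← lintegral_add_left_eq_self (μ := volume)
      (fun z => ENNReal.ofReal ((dist x z ^ m)⁻¹ * lap (lap w) z)) x]
    simp
  have hmeas : ∀ x : E, Measurable fun z => (dist x z ^ m)⁻¹ * lap (lap w) z := fun x => by
    have h2 := hlap.measurable
    fun_prop
  have hnn : ∀ x z : E, 0 ≤ (dist x z ^ m)⁻¹ * lap (lap w) z := fun x z =>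
    mul_nonneg (by positivity) (hlp z).le
  have hpos' : ∀ x, ENNReal.ofReal (w x * I) ≠ 0 := fun x =>
    (ENNReal.ofReal_pos.2 (mul_pos (hpos x) hI)).ne'
  have hc0 : c ≠ 0 := fun hc => hpos' 0 (by rw [hJ, hc, mul_zero])
  have hJ0 : ∀ x, ∫⁻ z, ENNReal.ofReal ((dist x z ^ m)⁻¹ * lap (lap w) z) ≠ 0 := fun x hc =>
    hpos' x (by rw [hJ, hc, zero_mul])
  have hJt : ∀ x, ∫⁻ z, ENNReal.ofReal ((dist x z ^ m)⁻¹ * lap (lap w) z) ≠ ⊤ := fun x hc =>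
    ENNReal.ofReal_ne_top (r := w x * I) (by rw [hJ, hc, ENNReal.top_mul hc0])
  have hct : c ≠ ⊤ := fun hc =>
    ENNReal.ofReal_ne_top (r := w 0 * I) (by rw [hJ, hc, ENNReal.mul_top (hJ0 0)])
  have h_int : ∀ x, Integrable fun z => (dist x z ^ m)⁻¹ * lap (lap w) z := fun x =>
    ⟨(hmeas x).aestronglyMeasurable, by
      rw [hasFiniteIntegral_iff_ofReal (.of_forall (hnn x))]
      exact (hJt x).lt_top⟩
  have hval : ∀ x, w x * I = (∫ z, (dist x z ^ m)⁻¹ * lap (lap w) z) * c.toReal := fun x => by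
    rw [integral_eq_lintegral_of_nonneg_ae (.of_forall (hnn x)) (hmeas x).aestronglyMeasurable,
      ← ENNReal.toReal_mul, ← hJ, ENNReal.toReal_ofReal (mul_pos (hpos x) hI).le]
  have hfun : ∀ x, (fun z => (dist x z ^ m)⁻¹ * lap (lap w) z) =
      fun z => κ * ((dist x z ^ m)⁻¹ * w z ^ p) := fun x => by
    funext z
    rw [hf]
    ring
  have hcr : 0 < c.toReal := ENNReal.toReal_pos hc0 hct
  refine ⟨κ * c.toReal / I, by positivity, fun x => ⟨?_, ?_⟩⟩
  · have := h_int x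
    rw [hfun] at this
    exact (integrable_const_mul_iff (isUnit_iff_ne_zero.2 hκ.ne') _).1 this
  · have := hval x
    rw [hfun, integral_const_mul] at this
    rw [div_mul_eq_mul_div, eq_div_iff hI.ne', this]
    ring

end Representation

section SmallSets

open Set Filter Topology MeasureTheory Metric
open scoped ContDiff ENNReal

variable {n : ℕ}

local notation "E" => EuclideanSpace ℝ (Fin n)

theorem integrableOn_inv_pow_norm {m : ℕ} {w : E → ℝ} (hw : Continuous w) (hpos : ∀ x, 0 < w x)
    {p : ℝ} (h_int : Integrable fun z => (dist 0 z ^ m)⁻¹ * w z ^ p) :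
    IntegrableOn (fun z : E => (‖z‖ ^ m)⁻¹) (ball 0 1) := by
  have hwp : Continuous fun z => w z ^ p := hw.rpow_const fun z => Or.inl (hpos z).ne'
  obtain ⟨z₀, -, hz₀⟩ := (isCompact_closedBall (0 : E) 1).exists_isMinOn
    ⟨0, mem_closedBall_self zero_le_one⟩ hwp.continuousOn
  have hc : 0 < w z₀ ^ p := Real.rpow_pos_of_pos (hpos _) _
  refine Integrable.mono' ((h_int.const_mul (w z₀ ^ p)⁻¹).integrableOn (s := ball 0 1)) ?_ ?_
  · exact Measurable.aestronglyMeasurable (by fun_prop)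
  · refine (ae_restrict_iff' measurableSet_ball).2 (.of_forall fun z hz => ?_)
    have h1 : w z₀ ^ p ≤ w z ^ p := hz₀ (ball_subset_closedBall hz)
    rw [Real.norm_of_nonneg (by positivity), dist_zero_left, mul_comm, mul_assoc]
    exact le_mul_of_one_le_right (by positivity) (by rwa [← div_eq_mul_inv, one_le_div hc])

theorem exists_forall_setIntegral_inv_pow_dist_le {m : ℕ}
    (hloc : IntegrableOn (fun z : E => (‖z‖ ^ m)⁻¹) (ball 0 1)) {ε : ℝ} (hε : 0 < ε) :
    ∃ η : ℝ≥0∞, 0 < η ∧ ∀ (y : E) (A : Set E), MeasurableSet A → volume A < η →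
      IntegrableOn (fun z => (dist y z ^ m)⁻¹) A ∧ ∫ z in A, (dist y z ^ m)⁻¹ ≤ ε := by
  set F : E → ℝ≥0∞ := (ball 0 1).indicator fun z => ENNReal.ofReal (‖z‖ ^ m)⁻¹ with hF
  have hFm : Measurable F := Measurable.indicator (by fun_prop) measurableSet_ball
  have hFi : ∫⁻ z, F z ≠ ⊤ := by
    rw [hF, lintegral_indicator measurableSet_ball]
    have := hloc.2
    rw [hasFiniteIntegral_iff_ofReal (.of_forall fun z => by positivity)] at this
    exact this.ne
  have hε2 : ENNReal.ofReal (ε / 2) ≠ 0 := (ENNReal.ofReal_pos.2 (half_pos hε)).ne'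
  obtain ⟨δ, hδ, hδ'⟩ := exists_pos_setLIntegral_lt_of_measure_lt hFi hε2
  refine ⟨min δ (ENNReal.ofReal (ε / 2)), lt_min hδ (pos_iff_ne_zero.2 hε2), fun y A hA hvol => ?_⟩
  have hle : ∀ z : E, ENNReal.ofReal (dist y z ^ m)⁻¹ ≤ F (z - y) + 1 := by
    intro z
    rw [dist_comm, dist_eq_norm]
    by_cases h : z - y ∈ ball (0 : E) 1
    · rw [hF, indicator_of_mem h]
      exact le_self_add
    · rw [mem_ball_zero_iff, not_lt] at h
      refine le_trans ?_ le_add_self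
      rw [← ENNReal.ofReal_one]
      exact ENNReal.ofReal_le_ofReal (inv_le_one_of_one_le₀ (one_le_pow₀ h))
  have hA1 : ∫⁻ z in A, F (z - y) ≤ ENNReal.ofReal (ε / 2) := by
    have hmp : MeasurePreserving (fun z : E => z + y) := measurePreserving_add_right volume y
    have h1 := hmp.setLIntegral_comp_preimage hA (f := fun z => F (z - y))
      (hFm.comp (measurable_id.sub_const y))
    rw [← h1]
    simp only [add_sub_cancel_right]
    refine (hδ' _ ?_).le
    rw [hmp.measure_preimage hA.nullMeasurableSet]
    exact hvol.trans_le (min_le_left _ _)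
  have hkey : ∫⁻ z in A, ENNReal.ofReal (dist y z ^ m)⁻¹ ≤ ENNReal.ofReal ε := by
    calc _ ≤ ∫⁻ z in A, (F (z - y) + 1) := lintegral_mono hle
      _ = (∫⁻ z in A, F (z - y)) + volume A := by
        rw [lintegral_add_right _ measurable_const, lintegral_one, Measure.restrict_apply_univ]
      _ ≤ ENNReal.ofReal (ε / 2) + ENNReal.ofReal (ε / 2) :=
        add_le_add hA1 (hvol.le.trans (min_le_right _ _))
      _ = _ := by rw [← ENNReal.ofReal_add (by positivity) (by positivity), add_halves]
  have hm : Measurable fun z : E => (dist y z ^ m)⁻¹ := by fun_prop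
  have hnn : ∀ z : E, 0 ≤ (dist y z ^ m)⁻¹ := fun z => by positivity
  refine ⟨⟨hm.aestronglyMeasurable, ?_⟩, ?_⟩
  · rw [hasFiniteIntegral_iff_ofReal (.of_forall hnn)]
    exact hkey.trans_lt ENNReal.ofReal_lt_top
  · rw [integral_eq_lintegral_of_nonneg_ae (.of_forall hnn) hm.aestronglyMeasurable]
    exact ENNReal.toReal_le_of_le_ofReal hε.le hkey

end SmallSets

section Kelvin

open Set Filter Topology MeasureTheory Metric EuclideanGeometry
open scoped ContDiff ENNReal

variable {n : ℕ}

local notation "E" => EuclideanSpace ℝ (Fin n)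

/-- The open ball of radius `r` about `c` with its center removed. -/
def puncturedBall (c : E) (r : ℝ) : Set E := ball c r \ {c}

/-- The Kelvin transform of `u` in the sphere of center `c` and radius `r`, with weight `m`. -/
noncomputable def kelvin (m : ℕ) (c : E) (r : ℝ) (u : E → ℝ) (y : E) : ℝ :=
  (r / dist y c) ^ m * u (inversion c r y)

theorem measurableSet_puncturedBall (c : E) (r : ℝ) : MeasurableSet (puncturedBall c r) :=
  measurableSet_ball.diff (measurableSet_singleton c)

theorem dist_pos_of_mem_puncturedBall {c : E} {r : ℝ} {y : E} (hy : y ∈ puncturedBall c r) :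
    0 < dist y c :=
  dist_pos.2 hy.2

theorem dist_lt_of_mem_puncturedBall {c : E} {r : ℝ} {y : E} (hy : y ∈ puncturedBall c r) :
    dist y c < r :=
  hy.1

theorem kelvin_pos (m : ℕ) {c : E} {r : ℝ} (hr : 0 < r) {u : E → ℝ} (hu : ∀ x, 0 < u x) {y : E}
    (hy : y ≠ c) : 0 < kelvin m c r u y :=
  mul_pos (pow_pos (div_pos hr (dist_pos.2 hy)) _) (hu _)

theorem inversion_image_puncturedBall (c : E) {r : ℝ} (hr : 0 < r) :
    inversion c r '' puncturedBall c r = (closedBall c r)ᶜ := by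
  ext z
  simp only [mem_image, mem_compl_iff, mem_closedBall, not_le]
  constructor
  · rintro ⟨y, hy, rfl⟩
    rw [dist_inversion_center, lt_div_iff₀ (dist_pos_of_mem_puncturedBall hy)]
    nlinarith [dist_lt_of_mem_puncturedBall hy]
  · intro hz
    have hz0 : 0 < dist z c := hr.trans hz
    refine ⟨inversion c r z, ⟨?_, ?_⟩, inversion_inversion c hr.ne' z⟩
    · rw [mem_ball, dist_inversion_center, div_lt_iff₀ hz0]
      nlinarith
    · simpa [inversion_eq_center hr.ne'] using dist_pos.1 hz0

theorem abs_det_fderiv_inversion (c z : E) (r : ℝ) :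
    |((r / dist z c) ^ 2 • ((ℝ ∙ (z - c))ᗮ.reflection : E →L[ℝ] E)).det| =
      (r / dist z c) ^ (2 * n) := by
  have h1 : ((r / dist z c) ^ 2 • ((ℝ ∙ (z - c))ᗮ.reflection : E →L[ℝ] E)).det =
      LinearMap.det ((r / dist z c) ^ 2 • (ℝ ∙ (z - c))ᗮ.reflection.toLinearMap) := rfl
  rw [h1, LinearMap.det_smul, Submodule.det_reflection, finrank_euclideanSpace_fin, abs_mul]
  simp [abs_of_nonneg, pow_mul, abs_pow]

theorem integral_eq_add_inversion (hn : 0 < n) (c : E) {r : ℝ} (hr : 0 < r) {g : E → ℝ}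
    (hg : Integrable g) :
    IntegrableOn (fun z => (r / dist z c) ^ (2 * n) * g (inversion c r z)) (puncturedBall c r) ∧
      ∫ z, g z = (∫ z in puncturedBall c r, g z) +
        ∫ z in puncturedBall c r, (r / dist z c) ^ (2 * n) * g (inversion c r z) := by
  have : Nontrivial E := by
    have : Nonempty (Fin n) := ⟨⟨0, hn⟩⟩
    exact inferInstance
  have hd : ∀ z ∈ puncturedBall c r, HasFDerivWithinAt (inversion c r)
      ((r / dist z c) ^ 2 • ((ℝ ∙ (z - c))ᗮ.reflection : E →L[ℝ] E)) (puncturedBall c r) z :=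
    fun z hz => (hasFDerivAt_inversion hz.2).hasFDerivWithinAt
  have hinj : InjOn (inversion c r) (puncturedBall c r) := (inversion_injective c hr.ne').injOn
  have hB := measurableSet_puncturedBall c r
  have h1 := integrableOn_image_iff_integrableOn_abs_det_fderiv_smul volume hB hd hinj g
  have h2 := integral_image_eq_integral_abs_det_fderiv_smul volume hB hd hinj g
  simp only [abs_det_fderiv_inversion, smul_eq_mul, inversion_image_puncturedBall c hr] at h1 h2
  refine ⟨h1.1 hg.integrableOn, ?_⟩
  rw [← h2]
  have h3 : (puncturedBall c r : Set E) =ᵐ[volume] closedBall c r := by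
    refine (sdiff_null_ae_eq_self (measure_singleton c)).trans ?_
    exact ae_eq_of_subset_of_measure_ge ball_subset_closedBall
      (Measure.addHaar_closedBall_eq_addHaar_ball volume c r).le
      measurableSet_ball.nullMeasurableSet measure_closedBall_lt_top.ne
  rw [setIntegral_congr_set h3, integral_add_compl measurableSet_closedBall hg]

theorem rpow_comp_inversion {m : ℕ} (hm : 0 < m) {p : ℝ} (hp : p = (m + 8) / m) {c : E} {r : ℝ}
    (hr : 0 < r) {u : E → ℝ} (hu : ∀ x, 0 < u x) {z : E} (hz : z ≠ c) :
    (r / dist z c) ^ (m + 8) * u (inversion c r z) ^ p = kelvin m c r u z ^ p := by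
  have ha : 0 < r / dist z c := div_pos hr (dist_pos.2 hz)
  rw [kelvin, Real.mul_rpow (by positivity) (hu _).le]
  congr 1
  rw [← Real.rpow_natCast, ← Real.rpow_natCast, ← Real.rpow_mul ha.le, hp]
  congr 1
  push_cast
  field_simp

end Kelvin

section ReflectedKernel

open Set Filter Topology MeasureTheory Metric EuclideanGeometry
open scoped ContDiff ENNReal

variable {n : ℕ}

local notation "E" => EuclideanSpace ℝ (Fin n)

/-- The Riesz kernel `(dist y z ^ m)⁻¹` reflected in the sphere of center `c` and radius `r`. -/
noncomputable def reflKernel (m : ℕ) (c : E) (r : ℝ) (y z : E) : ℝ :=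
  (r / dist z c) ^ m * (dist y (inversion c r z) ^ m)⁻¹

theorem reflKernel_nonneg (m : ℕ) (c : E) {r : ℝ} (hr : 0 < r) (y z : E) :
    0 ≤ reflKernel m c r y z := by
  rw [reflKernel]
  positivity

theorem mul_inv_dist_inversion_pow (m : ℕ) {c : E} {r : ℝ} (hr : 0 < r) {y z : E} (hy : y ≠ c)
    (hz : z ≠ c) :
    (r / dist y c) ^ m * (dist (inversion c r y) z ^ m)⁻¹ = reflKernel m c r y z := by
  have hy' : 0 < dist y c := dist_pos.2 hy
  have hz' : 0 < dist z c := dist_pos.2 hz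
  have h1 := dist_inversion_inversion ((inversion_eq_center hr.ne').not.2 hy) hz r
  rw [inversion_inversion c hr.ne', dist_inversion_center] at h1
  have h2 : dist y (inversion c r z) = dist y c / dist z c * dist (inversion c r y) z := by
    rw [h1]
    field_simp
  rw [reflKernel, h2, mul_pow, mul_inv, ← mul_assoc, ← inv_pow, ← inv_pow,
    ← mul_pow, ← mul_pow, ← mul_pow]
  congr 1
  field_simp

theorem mul_reflKernel_inversion (m : ℕ) {c : E} {r : ℝ} (hr : 0 < r) {y z : E} (hy : y ≠ c)
    (hz : z ≠ c) :
    (r / dist y c) ^ m * reflKernel m c r (inversion c r y) z = (dist y z ^ m)⁻¹ := by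
  have hy' : 0 < dist y c := dist_pos.2 hy
  have hz' : 0 < dist z c := dist_pos.2 hz
  rw [reflKernel, dist_inversion_inversion hy hz, ← mul_assoc, ← mul_pow, ← inv_pow, ← mul_pow,
    ← inv_pow]
  congr 1
  rw [mul_inv, ← mul_assoc]
  field_simp

theorem dist_lt_mul_dist_inversion {c : E} {r : ℝ} {y z : E}
    (hy : y ∈ puncturedBall c r) (hz : z ∈ puncturedBall c r) :
    dist y z < dist z c / r * dist y (inversion c r z) := by
  have hy0 := dist_pos_of_mem_puncturedBall hy
  have hz0 := dist_pos_of_mem_puncturedBall hz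
  have hy1 := dist_lt_of_mem_puncturedBall hy
  have hz1 := dist_lt_of_mem_puncturedBall hz
  have hr : 0 < r := hy0.trans hy1
  refine lt_of_pow_lt_pow_left₀ 2 (by positivity) ?_
  rw [← sub_pos]
  have h1 : dist y z ^ 2 = dist y c ^ 2 - 2 * inner ℝ (y - c) (z - c) + dist z c ^ 2 := by
    rw [dist_eq_norm, dist_eq_norm, dist_eq_norm, ← norm_sub_sq_real]
    congr 2
    abel
  have h2 : dist y (inversion c r z) ^ 2 = dist y c ^ 2 -
      2 * ((r / dist z c) ^ 2 * inner ℝ (y - c) (z - c)) +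
        ((r / dist z c) ^ 2) ^ 2 * dist z c ^ 2 := by
    have h3 : y - inversion c r z = (y - c) - (r / dist z c) ^ 2 • (z - c) := by
      simp only [inversion, vsub_eq_sub, vadd_eq_add]
      abel
    rw [dist_eq_norm, h3, norm_sub_sq_real, inner_smul_right, norm_smul, mul_pow,
      Real.norm_of_nonneg (by positivity : 0 ≤ (r / dist z c) ^ 2), dist_eq_norm y c,
      dist_eq_norm z c]
  have h4 : (dist z c / r * dist y (inversion c r z)) ^ 2 - dist y z ^ 2 =
      (r ^ 2 - dist y c ^ 2) * (r ^ 2 - dist z c ^ 2) / r ^ 2 := by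
    rw [mul_pow, h2, h1]
    field_simp
    ring
  rw [h4]
  have h5 : 0 < r ^ 2 - dist y c ^ 2 := by nlinarith
  have h6 : 0 < r ^ 2 - dist z c ^ 2 := by nlinarith
  positivity

theorem reflKernel_lt {m : ℕ} (hm : 0 < m) {c : E} {r : ℝ} {y z : E}
    (hy : y ∈ puncturedBall c r) (hz : z ∈ puncturedBall c r) (hyz : y ≠ z) :
    reflKernel m c r y z < (dist y z ^ m)⁻¹ := by
  have h1 := dist_lt_mul_dist_inversion hy hz
  have h0 : 0 < dist y z := dist_pos.2 hyz
  have hz0 := dist_pos_of_mem_puncturedBall hz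
  have hr : 0 < r := hz0.trans (dist_lt_of_mem_puncturedBall hz)
  have h2 : reflKernel m c r y z = ((dist z c / r * dist y (inversion c r z)) ^ m)⁻¹ := by
    rw [reflKernel, ← inv_pow, ← inv_pow, ← mul_pow, mul_inv, inv_div]
  rw [h2]
  exact inv_strictAnti₀ (by positivity) (pow_lt_pow_left₀ h1 h0.le hm.ne')

/-- `u` is a positive continuous solution of the conformally invariant integral equation on `ℝⁿ`
with Riesz kernel of order `m = n - 4`. -/
structure IsRieszSolution (m : ℕ) (C p : ℝ) (u : E → ℝ) : Prop where
  dim_eq : n = m + 4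
  pos_dim : 0 < m
  pos_const : 0 < C
  exponent : p = (m + 8) / m
  continuous : Continuous u
  pos : ∀ x, 0 < u x
  integrable : ∀ x, Integrable fun z => (dist x z ^ m)⁻¹ * u z ^ p
  eq_integral : ∀ x, u x = C * ∫ z, (dist x z ^ m)⁻¹ * u z ^ p

theorem IsRieszSolution.eq_integral_puncturedBall {m : ℕ} {C p : ℝ} {u : E → ℝ}
    (h : IsRieszSolution m C p u) (c : E) {r : ℝ} (hr : 0 < r)
    (x : E) :
    IntegrableOn (fun z => (dist x z ^ m)⁻¹ * u z ^ p) (puncturedBall c r) ∧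
    IntegrableOn (fun z => reflKernel m c r x z * kelvin m c r u z ^ p) (puncturedBall c r) ∧
    u x = C * ((∫ z in puncturedBall c r, (dist x z ^ m)⁻¹ * u z ^ p) +
      ∫ z in puncturedBall c r, reflKernel m c r x z * kelvin m c r u z ^ p) := by
  have hn : 0 < n := by have := h.dim_eq; omega
  obtain ⟨h1, h2⟩ := integral_eq_add_inversion hn c hr (h.integrable x)
  have h3 : ∀ z ∈ puncturedBall c r, (r / dist z c) ^ (2 * n) *
      ((dist x (inversion c r z) ^ m)⁻¹ * u (inversion c r z) ^ p) =
        reflKernel m c r x z * kelvin m c r u z ^ p := by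
    intro z hz
    rw [← rpow_comp_inversion h.pos_dim h.exponent hr h.pos hz.2, reflKernel,
      show 2 * n = m + (m + 8) by have := h.dim_eq; omega, pow_add]
    ring
  have hB := measurableSet_puncturedBall c r
  rw [setIntegral_congr_fun hB h3] at h2
  exact ⟨(h.integrable x).integrableOn, h1.congr_fun h3 hB, by rw [← h2]; exact h.eq_integral x⟩

theorem IsRieszSolution.kelvin_eq_integral_puncturedBall {m : ℕ} {C p : ℝ} {u : E → ℝ}
    (h : IsRieszSolution m C p u) {c : E} {r : ℝ}
    (hr : 0 < r) {y : E} (hy : y ≠ c) :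
    IntegrableOn (fun z => reflKernel m c r y z * u z ^ p) (puncturedBall c r) ∧
    IntegrableOn (fun z => (dist y z ^ m)⁻¹ * kelvin m c r u z ^ p) (puncturedBall c r) ∧
    kelvin m c r u y = C * ((∫ z in puncturedBall c r, reflKernel m c r y z * u z ^ p) +
      ∫ z in puncturedBall c r, (dist y z ^ m)⁻¹ * kelvin m c r u z ^ p) := by
  obtain ⟨h1, h2, h3⟩ := h.eq_integral_puncturedBall c hr (inversion c r y)
  have hB := measurableSet_puncturedBall c r
  have e1 : ∀ z ∈ puncturedBall c r, (r / dist y c) ^ m *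
      ((dist (inversion c r y) z ^ m)⁻¹ * u z ^ p) = reflKernel m c r y z * u z ^ p := by
    intro z hz
    rw [← mul_assoc, mul_inv_dist_inversion_pow m hr hy hz.2]
  have e2 : ∀ z ∈ puncturedBall c r, (r / dist y c) ^ m *
      (reflKernel m c r (inversion c r y) z * kelvin m c r u z ^ p) =
        (dist y z ^ m)⁻¹ * kelvin m c r u z ^ p := by
    intro z hz
    rw [← mul_assoc, mul_reflKernel_inversion m hr hy hz.2]
  refine ⟨IntegrableOn.congr_fun (h1.const_mul _) e1 hB,
    IntegrableOn.congr_fun (h2.const_mul _) e2 hB, ?_⟩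
  rw [← setIntegral_congr_fun hB e1, ← setIntegral_congr_fun hB e2, integral_const_mul,
    integral_const_mul, kelvin, h3]
  ring

theorem IsRieszSolution.sub_kelvin_eq_integral {m : ℕ} {C p : ℝ} {u : E → ℝ}
    (h : IsRieszSolution m C p u) {c : E} {r : ℝ}
    (hr : 0 < r) {y : E} (hy : y ≠ c) :
    IntegrableOn (fun z => ((dist y z ^ m)⁻¹ - reflKernel m c r y z) *
      (u z ^ p - kelvin m c r u z ^ p)) (puncturedBall c r) ∧
    u y - kelvin m c r u y = C * ∫ z in puncturedBall c r,
      ((dist y z ^ m)⁻¹ - reflKernel m c r y z) * (u z ^ p - kelvin m c r u z ^ p) := by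
  obtain ⟨h1, h2, h3⟩ := h.eq_integral_puncturedBall c hr y
  obtain ⟨h4, h5, h6⟩ := h.kelvin_eq_integral_puncturedBall hr hy
  have e : (fun z => ((dist y z ^ m)⁻¹ - reflKernel m c r y z) *
      (u z ^ p - kelvin m c r u z ^ p)) = fun z =>
      ((dist y z ^ m)⁻¹ * u z ^ p + reflKernel m c r y z * kelvin m c r u z ^ p) -
        (reflKernel m c r y z * u z ^ p + (dist y z ^ m)⁻¹ * kelvin m c r u z ^ p) := by
    funext z
    ring
  rw [e]
  refine ⟨(h1.add h2).sub (h4.add h5), ?_⟩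
  have hsub := integral_sub (h1.add h2) (h4.add h5)
  simp only [Pi.add_apply] at hsub
  rw [hsub, integral_add h1 h2, integral_add h4 h5, mul_sub,
    ← h3, ← h6]

end ReflectedKernel

section MovingSpheres

open Set Filter Topology MeasureTheory Metric EuclideanGeometry
open scoped ContDiff ENNReal

variable {n : ℕ}

local notation "E" => EuclideanSpace ℝ (Fin n)

theorem rpow_sub_rpow_le {a b M p : ℝ} (hb : 0 ≤ b) (hba : b ≤ a) (haM : a ≤ M) (ha : 0 < a)
    (hp : 1 ≤ p) : a ^ p - b ^ p ≤ p * M ^ (p - 1) * (a - b) := by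
  have h1 := one_add_mul_self_le_rpow_one_add (s := b / a - 1) (by
    have : 0 ≤ b / a := by positivity
    linarith) hp
  rw [add_sub_cancel, Real.div_rpow hb ha.le] at h1
  have h2 : a ^ p = a ^ (p - 1) * a := by
    rw [← Real.rpow_add_one ha.ne', sub_add_cancel]
  have h3 : a ^ (p - 1) ≤ M ^ (p - 1) := Real.rpow_le_rpow ha.le haM (by linarith)
  have hap : 0 < a ^ p := Real.rpow_pos_of_pos ha p
  rw [le_div_iff₀ hap] at h1
  have h4 : (1 + p * (b / a - 1)) * a ^ p = a ^ p - p * a ^ (p - 1) * (a - b) := by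
    rw [h2]
    field_simp
    ring
  have h5 : p * a ^ (p - 1) * (a - b) ≤ p * M ^ (p - 1) * (a - b) := by
    have : 0 ≤ a - b := by linarith
    gcongr
  linarith

theorem measurable_kelvin (m : ℕ) (c : E) (r : ℝ) {u : E → ℝ} (hu : Continuous u) :
    Measurable (kelvin m c r u) := by
  have h := hu.measurable
  have h2 : Measurable fun y : E => inversion c r y := by
    simp only [inversion, vsub_eq_sub, vadd_eq_add]
    fun_prop
  unfold kelvin
  fun_prop

theorem continuousAt_kelvin (m : ℕ) {c : E} (r : ℝ) {u : E → ℝ} (hu : Continuous u) {y : E}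
    (hy : y ≠ c) : ContinuousAt (kelvin m c r u) y := by
  have h2 : ContinuousAt (fun y : E => inversion c r y) y :=
    continuousAt_const.inversion continuousAt_const continuousAt_id hy
  have h3 : dist y c ≠ 0 := dist_ne_zero.2 hy
  have h4 : ContinuousAt (fun y => u (inversion c r y)) y := ContinuousAt.comp hu.continuousAt h2
  unfold kelvin
  refine ContinuousAt.mul ?_ h4
  fun_prop (disch := assumption)

theorem continuous_kelvin_radius (m : ℕ) (c : E) {u : E → ℝ} (hu : Continuous u) (y : E) :
    Continuous fun r => kelvin m c r u y := by
  have h2 : Continuous fun r : ℝ => inversion c r y := by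
    simp only [inversion, vsub_eq_sub, vadd_eq_add]
    fun_prop
  unfold kelvin
  fun_prop

/-- The points of the punctured ball at which `u` exceeds its Kelvin transform. -/
def kelvinViolationSet (m : ℕ) (c : E) (r : ℝ) (u : E → ℝ) : Set E :=
  {y ∈ puncturedBall c r | kelvin m c r u y < u y}

theorem measurableSet_kelvinViolationSet (m : ℕ) (c : E) (r : ℝ) {u : E → ℝ} (hu : Continuous u) :
    MeasurableSet (kelvinViolationSet m c r u) :=
  (measurableSet_puncturedBall c r).inter
    (measurableSet_lt (measurable_kelvin m c r hu) hu.measurable)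

theorem IsRieszSolution.one_le_exponent {m : ℕ} {C p : ℝ} {u : E → ℝ}
    (h : IsRieszSolution m C p u) : 1 ≤ p := by
  have hm : (0 : ℝ) < m := by exact_mod_cast h.pos_dim
  rw [h.exponent, one_le_div hm]
  linarith

theorem IsRieszSolution.exists_measure_bound {m : ℕ} {C p : ℝ} {u : E → ℝ}
    (h : IsRieszSolution m C p u) {M : ℝ} (hM : ∀ x, u x ≤ M) :
    ∃ η : ℝ≥0∞, 0 < η ∧ ∀ (c : E) (r : ℝ), 0 < r →
      volume (kelvinViolationSet m c r u) < η →
        ∀ y ∈ puncturedBall c r, u y ≤ kelvin m c r u y := by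
  have hp := h.one_le_exponent
  have hC := h.pos_const
  have hM0 : 0 < M := (h.pos 0).trans_le (hM 0)
  set K := p * M ^ (p - 1)
  have hK : 0 < K := mul_pos (by linarith) (Real.rpow_pos_of_pos hM0 _)
  obtain ⟨η, hη, hη'⟩ := exists_forall_setIntegral_inv_pow_dist_le (m := m)
    (integrableOn_inv_pow_norm h.continuous h.pos (h.integrable 0))
    (ε := 1 / (2 * C * K)) (by positivity)
  refine ⟨η, hη, fun c r hr hvol => ?_⟩
  set A := kelvinViolationSet m c r u
  have hA : MeasurableSet A := measurableSet_kelvinViolationSet m c r h.continuous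
  by_contra! hcon
  obtain ⟨y₀, hy₀, hlt⟩ := hcon
  have hy₀A : y₀ ∈ A := ⟨hy₀, hlt⟩
  set D := (fun y => u y - kelvin m c r u y) '' A
  have hbdd : BddAbove D := by
    refine ⟨M, ?_⟩
    rintro _ ⟨y, hy, rfl⟩
    have := kelvin_pos m hr h.pos hy.1.2
    have := hM y
    simp only
    linarith
  set S := sSup D
  have hS : 0 < S := lt_of_lt_of_le (sub_pos.2 hlt) (le_csSup hbdd ⟨y₀, hy₀A, rfl⟩)
  have hle : ∀ d ∈ D, d ≤ S / 2 := by
    rintro _ ⟨y, hy, rfl⟩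
    obtain ⟨i1, i2⟩ := h.sub_kelvin_eq_integral hr hy.1.2
    obtain ⟨i3, i4⟩ := hη' y A hA hvol
    simp only
    rw [i2]
    have hAB : A ⊆ puncturedBall c r := fun y hy => hy.1
    have hbound : ∫ z in puncturedBall c r, ((dist y z ^ m)⁻¹ - reflKernel m c r y z) *
        (u z ^ p - kelvin m c r u z ^ p) ≤ ∫ z in A, (dist y z ^ m)⁻¹ * (K * S) := by
      rw [← inter_eq_right.2 hAB, ← setIntegral_indicator hA]
      refine integral_mono_ae i1 ?_ ?_
      · exact ((integrable_indicator_iff hA).2 (i3.mul_const (K * S))).integrableOn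
      · have hBm := measurableSet_puncturedBall c r
        have hne : ∀ᵐ z ∂(volume : Measure E).restrict (puncturedBall c r), z ≠ y :=
          ae_restrict_of_ae (compl_mem_ae_iff.2 (by
            have : Nontrivial E := ⟨⟨y, c, hy.1.2⟩⟩
            exact measure_singleton y))
        filter_upwards [hne, ae_restrict_mem hBm] with z hzy hz
        have hk := reflKernel_lt h.pos_dim hy.1 hz hzy.symm
        have hk0 := reflKernel_nonneg m c hr y z
        have hkz := kelvin_pos m hr h.pos hz.2
        by_cases hzA : z ∈ A
        · rw [indicator_of_mem hzA]
          have h1 : u z ^ p - kelvin m c r u z ^ p ≤ K * S := by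
            refine (rpow_sub_rpow_le hkz.le hzA.2.le (hM z) (h.pos z) hp).trans ?_
            exact mul_le_mul_of_nonneg_left (le_csSup hbdd ⟨z, hzA, rfl⟩) hK.le
          have h2 : 0 ≤ u z ^ p - kelvin m c r u z ^ p :=
            sub_nonneg.2 (Real.rpow_le_rpow hkz.le hzA.2.le (by linarith))
          exact mul_le_mul (by linarith) h1 h2 (by positivity)
        · rw [indicator_of_notMem hzA]
          have h1 : u z ≤ kelvin m c r u z := not_lt.1 fun hlt => hzA ⟨hz, hlt⟩
          have h2 : u z ^ p ≤ kelvin m c r u z ^ p :=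
            Real.rpow_le_rpow (h.pos z).le h1 (by linarith)
          exact mul_nonpos_of_nonneg_of_nonpos (by linarith) (by linarith)
    calc _ ≤ C * ∫ z in A, (dist y z ^ m)⁻¹ * (K * S) := by gcongr
      _ = C * ((∫ z in A, (dist y z ^ m)⁻¹) * (K * S)) := by rw [integral_mul_const]
      _ ≤ C * (1 / (2 * C * K) * (K * S)) := by gcongr
      _ = S / 2 := by field_simp
  have := csSup_le ⟨_, mem_image_of_mem _ hy₀A⟩ hle
  change S ≤ S / 2 at this
  linarith

end MovingSpheres

section SphereDichotomy

open Set Filter Topology MeasureTheory Metric EuclideanGeometry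
open scoped ContDiff ENNReal

variable {n : ℕ}

local notation "E" => EuclideanSpace ℝ (Fin n)

/-- Inside the sphere of center `c` and radius `r`, `u` lies below its Kelvin transform. -/
def KelvinDominates (m : ℕ) (c : E) (r : ℝ) (u : E → ℝ) : Prop :=
  ∀ y ∈ puncturedBall c r, u y ≤ kelvin m c r u y

theorem IsRieszSolution.eventually_kelvinDominates {m : ℕ} {C p : ℝ} {u : E → ℝ}
    (h : IsRieszSolution m C p u) {M : ℝ} (hM : ∀ x, u x ≤ M) (c : E) :
    ∀ᶠ r in 𝓝[>] (0 : ℝ), KelvinDominates m c r u := by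
  obtain ⟨η, hη, hη'⟩ := h.exists_measure_bound hM
  have hn : n ≠ 0 := by have := h.dim_eq; omega
  have hlim : Tendsto (fun r : ℝ => ENNReal.ofReal (r ^ n) * volume (ball (0 : E) 1)) (𝓝[>] 0)
      (𝓝 0) := by
    have h1 : Tendsto (fun r : ℝ => ENNReal.ofReal (r ^ n)) (𝓝[>] 0) (𝓝 0) := by
      have : Continuous fun r : ℝ => ENNReal.ofReal (r ^ n) :=
        ENNReal.continuous_ofReal.comp (continuous_pow n)
      have h2 := this.tendsto 0
      simp only [ne_eq, hn, not_false_eq_true, zero_pow, ENNReal.ofReal_zero] at h2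
      exact h2.mono_left nhdsWithin_le_nhds
    simpa using ENNReal.Tendsto.mul_const h1 (Or.inr (measure_ball_lt_top (μ := volume)).ne)
  filter_upwards [hlim.eventually_lt_const hη, self_mem_nhdsWithin] with r hr hr0
  have hr0 : 0 < r := hr0
  refine hη' c r hr0 (lt_of_le_of_lt (measure_mono fun y hy => hy.1.1) ?_)
  have := Measure.addHaar_ball_of_pos (volume : Measure E) c hr0
  rw [finrank_euclideanSpace_fin] at this
  rwa [this]

theorem IsRieszSolution.eq_or_lt_kelvin {m : ℕ} {C p : ℝ} {u : E → ℝ}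
    (h : IsRieszSolution m C p u) {c : E} {r : ℝ} (hr : 0 < r) (hd : KelvinDominates m c r u) :
    (∀ y ∈ puncturedBall c r, u y = kelvin m c r u y) ∨
      ∀ y ∈ puncturedBall c r, u y < kelvin m c r u y := by
  by_cases heq : ∀ y ∈ puncturedBall c r, u y = kelvin m c r u y
  · exact Or.inl heq
  push Not at heq
  obtain ⟨y₀, hy₀, hne⟩ := heq
  refine Or.inr fun y hy => ?_
  have hp := h.one_le_exponent
  obtain ⟨i1, i2⟩ := h.sub_kelvin_eq_integral hr hy.2
  set g : E → ℝ := fun z => ((dist y z ^ m)⁻¹ - reflKernel m c r y z) *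
    (u z ^ p - kelvin m c r u z ^ p)
  have hBm := measurableSet_puncturedBall c r
  have hnt : Nontrivial E := ⟨⟨y, c, hy.2⟩⟩
  have hk : ∀ z ∈ puncturedBall c r, z ≠ y → 0 < (dist y z ^ m)⁻¹ - reflKernel m c r y z :=
    fun z hz hzy => sub_pos.2 (reflKernel_lt h.pos_dim hy hz hzy.symm)
  have hpos : 0 < ∫ z in puncturedBall c r, (-g) z := by
    rw [setIntegral_pos_iff_support_of_nonneg_ae _ i1.neg]
    · have hopen : IsOpen (puncturedBall c r) := isOpen_ball.sdiff isClosed_singleton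
      have hlt₀ : u y₀ < kelvin m c r u y₀ := lt_of_le_of_ne (hd _ hy₀) hne
      have hev : ∀ᶠ z in 𝓝 y₀, z ∈ puncturedBall c r ∧ u z < kelvin m c r u z :=
        (hopen.eventually_mem hy₀).and
          (h.continuous.continuousAt.eventually_lt
            (continuousAt_kelvin m r h.continuous hy₀.2) hlt₀)
      obtain ⟨U, hU, hUo, hyU⟩ := _root_.eventually_nhds_iff.1 hev
      have hvol : 0 < volume (U \ {y}) := by
        rw [measure_sdiff_null (measure_singleton y)]
        exact hUo.measure_pos volume ⟨y₀, hyU⟩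
      refine hvol.trans_le (measure_mono fun z hz => ?_)
      obtain ⟨hzB, hzlt⟩ := hU z hz.1
      refine ⟨?_, hzB⟩
      have h2 : u z ^ p < kelvin m c r u z ^ p :=
        Real.rpow_lt_rpow (h.pos z).le hzlt (by linarith)
      exact neg_ne_zero.2 (mul_ne_zero (hk z hzB hz.2).ne' (sub_neg.2 h2).ne)
    · have hzy : ∀ᵐ z ∂(volume : Measure E).restrict (puncturedBall c r), z ≠ y :=
        ae_restrict_of_ae (compl_mem_ae_iff.2 (measure_singleton y))
      filter_upwards [hzy, ae_restrict_mem hBm] with z hzy hz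
      have h2 : u z ^ p ≤ kelvin m c r u z ^ p :=
        Real.rpow_le_rpow (h.pos z).le (hd z hz) (by linarith)
      exact neg_nonneg.2 (mul_nonpos_of_nonneg_of_nonpos (hk z hz hzy).le (by linarith))
  simp only [Pi.neg_apply, integral_neg] at hpos
  have := mul_pos h.pos_const hpos
  linarith

theorem IsRieszSolution.eventually_kelvinDominates_of_lt {m : ℕ} {C p : ℝ} {u : E → ℝ}
    (h : IsRieszSolution m C p u) {M : ℝ} (hM : ∀ x, u x ≤ M) {c : E} {r : ℝ} (hr : 0 < r)
    (hd : ∀ y ∈ puncturedBall c r, u y < kelvin m c r u y) :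
    ∀ᶠ s in 𝓝[>] r, KelvinDominates m c s u := by
  obtain ⟨η, hη, hη'⟩ := h.exists_measure_bound hM
  have hlim : Tendsto (fun s => volume (kelvinViolationSet m c s u)) (𝓝[>] r)
      (𝓝 (volume (∅ : Set E))) := by
    refine tendsto_measure_of_ae_tendsto_indicator (𝓝[>] r) MeasurableSet.empty
      (fun s => measurableSet_kelvinViolationSet m c s h.continuous)
      (measurableSet_ball (x := c) (ε := r + 1)) measure_ball_lt_top.ne ?_ ?_
    · filter_upwards [Ioo_mem_nhdsGT (lt_add_one r)] with s hs y hy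
      exact lt_trans hy.1.1 hs.2
    · have h1 : ∀ᵐ y ∂(volume : Measure E), y ∉ sphere c r :=
        compl_mem_ae_iff.2 (Measure.addHaar_sphere_of_ne_zero volume c hr.ne')
      filter_upwards [h1] with y hy
      rw [Metric.mem_sphere] at hy
      rcases lt_or_gt_of_ne hy with hlt | hgt
      · by_cases hyc : y = c
        · exact .of_forall fun s => ⟨fun hys => (hys.1.2 hyc).elim, fun hys => hys.elim⟩
        · have := (continuous_kelvin_radius m c h.continuous y).continuousAt.eventually_const_lt
            (hd y ⟨hlt, hyc⟩)
          filter_upwards [nhdsWithin_le_nhds this] with s hs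
          exact ⟨fun hys => (lt_asymm hs hys.2).elim, fun hys => hys.elim⟩
      · filter_upwards [Ioo_mem_nhdsGT hgt] with s hs
        exact ⟨fun hys => (lt_asymm hs.2 hys.1.1).elim, fun hys => hys.elim⟩
  rw [measure_empty] at hlim
  filter_upwards [hlim.eventually_lt_const hη, self_mem_nhdsWithin] with s hs hrs
  exact hη' c s (hr.trans hrs) hs

theorem IsRieszSolution.kelvinDominates_or_exists_eq {m : ℕ} {C p : ℝ} {u : E → ℝ}
    (h : IsRieszSolution m C p u) {M : ℝ} (hM : ∀ x, u x ≤ M) (c : E) :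
    (∀ r, 0 < r → KelvinDominates m c r u) ∨
      ∃ r, 0 < r ∧ ∀ y ∈ puncturedBall c r, u y = kelvin m c r u y := by
  by_cases hall : ∀ r, 0 < r → KelvinDominates m c r u
  · exact Or.inl hall
  refine Or.inr ?_
  set T := {r : ℝ | 0 < r ∧ ¬ KelvinDominates m c r u} with hT
  have hTne : T.Nonempty := by
    push Not at hall
    exact hall
  have hTb : BddBelow T := ⟨0, fun r hr => hr.1.le⟩
  set R := sInf T
  have hR : 0 < R := by
    obtain ⟨ε, hε, hε'⟩ := mem_nhdsGT_iff_exists_Ioo_subset.1 (h.eventually_kelvinDominates hM c)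
    refine lt_of_lt_of_le hε (le_csInf hTne fun r hr => ?_)
    by_contra! hlt
    exact hr.2 (hε' ⟨hr.1, hlt⟩)
  have hbelow : ∀ r ∈ Ioo 0 R, KelvinDominates m c r u := fun r hr => by
    by_contra hcon
    exact (csInf_le hTb ⟨hr.1, hcon⟩).not_gt hr.2
  have hRd : KelvinDominates m c R u := by
    intro y hy
    have h1 : Tendsto (fun r => kelvin m c r u y) (𝓝[<] R) (𝓝 (kelvin m c R u y)) :=
      ((continuous_kelvin_radius m c h.continuous y).tendsto R).mono_left nhdsWithin_le_nhds
    refine ge_of_tendsto h1 ?_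
    filter_upwards [Ioo_mem_nhdsLT (dist_lt_of_mem_puncturedBall hy)] with r hr
    exact hbelow r ⟨(dist_pos_of_mem_puncturedBall hy).trans hr.1, hr.2⟩ y ⟨hr.1, hy.2⟩
  refine ⟨R, hR, (h.eq_or_lt_kelvin hR hRd).resolve_right fun hlt => ?_⟩
  obtain ⟨s, hs, hs'⟩ := mem_nhdsGT_iff_exists_Ioo_subset.1
    (h.eventually_kelvinDominates_of_lt hM hR hlt)
  obtain ⟨r, hrT, hrs⟩ := exists_lt_of_csInf_lt hTne (show sInf T < s from hs)
  rcases (csInf_le hTb hrT).eq_or_lt with heq | hlt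
  · exact hrT.2 (heq ▸ hRd)
  · exact hrT.2 (hs' ⟨hlt, hrs⟩)

theorem kelvin_kelvin (m : ℕ) {c : E} {r : ℝ} (hr : 0 < r) (u : E → ℝ) {y : E} (hy : y ≠ c) :
    kelvin m c r (kelvin m c r u) y = u y := by
  have hy' : 0 < dist y c := dist_pos.2 hy
  rw [kelvin, kelvin, inversion_inversion c hr.ne', dist_inversion_center, ← mul_assoc,
    ← mul_pow]
  have : r / dist y c * (r / (r ^ 2 / dist y c)) = 1 := by field_simp
  rw [this, one_pow, one_mul]

theorem eq_kelvin_of_eq_on_puncturedBall {m : ℕ} {c : E} {r : ℝ} (hr : 0 < r) {u : E → ℝ}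
    (h : ∀ y ∈ puncturedBall c r, u y = kelvin m c r u y) {y : E} (hy : y ≠ c) :
    u y = kelvin m c r u y := by
  rcases lt_trichotomy (dist y c) r with hlt | heq | hgt
  · exact h y ⟨hlt, hy⟩
  · rw [kelvin, inversion_of_mem_sphere (Metric.mem_sphere.2 heq), heq, div_self hr.ne', one_pow,
      one_mul]
  · have h1 : y ∈ inversion c r '' puncturedBall c r := by
      rw [inversion_image_puncturedBall c hr]
      simpa using hgt
    obtain ⟨z, hz, rfl⟩ := h1
    have h2 : u z = kelvin m c r u z := h z hz
    have h3 := kelvin_kelvin m hr u hy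
    conv_rhs => rw [kelvin, inversion_inversion c hr.ne', h2]
    rw [← h3, kelvin, inversion_inversion c hr.ne']

end SphereDichotomy

section KelvinInvariance

open Set Filter Topology MeasureTheory Metric EuclideanGeometry
open scoped ContDiff ENNReal

variable {n : ℕ}

local notation "E" => EuclideanSpace ℝ (Fin n)

theorem not_forall_kelvinDominates_of_eq_kelvin {m : ℕ} (hn : 0 < n) (hm : 0 < m) {u : E → ℝ}
    (hu : ∀ x, 0 < u x) {M : ℝ} (hM : ∀ x, u x ≤ M) {c c' : E} {r : ℝ} (hr : 0 < r)
    (heq : ∀ y, y ≠ c → u y = kelvin m c r u y) :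
    ¬ ∀ s, 0 < s → KelvinDominates m c' s u := by
  intro hd
  have hM0 : 0 < M := (hu 0).trans_le (hM 0)
  set e : E := EuclideanSpace.single ⟨0, hn⟩ 1
  have he : ‖e‖ = 1 := by simp [e]
  set y := c' + e
  have hy : dist y c' = 1 := by simp [y, he]
  set B := (2 * r) ^ m * M / u y
  have hB : 0 < B := div_pos (by positivity) (hu y)
  set s := 2 + 2 * dist c' c + B
  have hs : 2 ≤ s := by have := dist_nonneg (x := c') (y := c); simp only [s]; linarith
  have hyB : y ∈ puncturedBall c' s := by
    refine ⟨?_, dist_pos.1 (by rw [hy]; exact one_pos)⟩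
    rw [mem_ball, hy]
    linarith
  have h1 := hd s (by linarith) y hyB
  rw [kelvin, hy, div_one] at h1
  set z := inversion c' s y
  have hz : dist z c' = s ^ 2 := by rw [dist_inversion_center, hy, div_one]
  have hz1 : s ^ 2 / 2 ≤ dist z c := by
    have h2 := dist_triangle z c c'
    rw [dist_comm c c'] at h2
    have h3 : 2 * dist c' c ≤ s ^ 2 := by
      simp only [s] at hs ⊢
      nlinarith [dist_nonneg (x := c') (y := c)]
    linarith
  have hzc : z ≠ c := dist_pos.1 (lt_of_lt_of_le (by positivity) hz1)
  have h2 : u z ≤ (2 * r / s ^ 2) ^ m * M := by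
    rw [heq z hzc, kelvin]
    have : r / dist z c ≤ 2 * r / s ^ 2 := by
      rw [div_le_div_iff₀ (dist_pos.2 hzc) (by positivity)]
      nlinarith
    have h0 : 0 ≤ r / dist z c := div_nonneg hr.le dist_nonneg
    exact mul_le_mul (pow_le_pow_left₀ h0 this m) (hM _) (hu _).le (by positivity)
  have h3 : u y ≤ (2 * r) ^ m * M / s ^ m := by
    calc u y ≤ s ^ m * u z := h1
      _ ≤ s ^ m * ((2 * r / s ^ 2) ^ m * M) := by gcongr
      _ = _ := by
        rw [div_pow, ← pow_mul, mul_comm 2 m, pow_mul]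
        field_simp
  have h4 : s ^ m ≤ B := by
    rw [le_div_iff₀ (by positivity)] at h3
    rw [le_div_iff₀ (hu y)]
    linarith
  have h5 : s ≤ s ^ m := le_self_pow₀ (by linarith) hm.ne'
  have : B < s := by have := dist_nonneg (x := c') (y := c); simp only [s]; linarith
  linarith

theorem le_of_forall_kelvinDominates {m : ℕ} {u : E → ℝ}
    (hd : ∀ (c : E) (r : ℝ), 0 < r → KelvinDominates m c r u) (a b : E) : u b ≤ u a := by
  rcases eq_or_ne a b with rfl | hab
  · exact le_rfl
  have hd0 : 0 < ‖b - a‖ := norm_pos_iff.2 (sub_ne_zero.2 hab.symm)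
  have hlim : Tendsto (fun s : ℝ => √(1 + s⁻¹) ^ m * u a) atTop (𝓝 (u a)) := by
    have h1 : Tendsto (fun s : ℝ => √(1 + s⁻¹)) atTop (𝓝 1) := by
      have := (tendsto_inv_atTop_zero (𝕜 := ℝ)).const_add 1
      simpa [Function.comp_def] using (Real.continuous_sqrt.tendsto _).comp this
    simpa using (h1.pow m).mul_const (u a)
  refine ge_of_tendsto hlim ?_
  filter_upwards [eventually_gt_atTop (0 : ℝ)] with s hs
  set x := b + s • (b - a)
  have hbx : dist b x = s * ‖b - a‖ := by
    rw [dist_eq_norm, sub_add_cancel_left, norm_neg, norm_smul, Real.norm_of_nonneg hs.le]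
  have hbx0 : 0 < dist b x := by rw [hbx]; positivity
  have hsq : 1 < √(1 + s⁻¹) := by
    rw [Real.lt_sqrt zero_le_one, one_pow]
    linarith [inv_pos.2 hs]
  have hrad : 0 < √(1 + s⁻¹) * dist b x := by positivity
  have h1 := hd x _ hrad b ⟨by rw [mem_ball]; exact lt_mul_of_one_lt_left hbx0 hsq,
    dist_pos.1 hbx0⟩
  rw [kelvin, mul_div_assoc, div_self hbx0.ne', mul_one] at h1
  have h2 : inversion x (√(1 + s⁻¹) * dist b x) b = a := by
    rw [inversion, mul_div_assoc, div_self hbx0.ne', mul_one, Real.sq_sqrt (by positivity),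
      vsub_eq_sub, vadd_eq_add, sub_add_cancel_left, add_smul, one_smul, smul_neg, smul_smul,
      inv_mul_cancel₀ hs.ne', one_smul]
    simp only [x]
    abel
  rwa [h2] at h1

theorem IsRieszSolution.exists_eq_kelvin {m : ℕ} {C p : ℝ} {u : E → ℝ}
    (h : IsRieszSolution m C p u) {M : ℝ} (hM : ∀ x, u x ≤ M) (hnc : ∃ a b, u a < u b) (c : E) :
    ∃ r, 0 < r ∧ ∀ y, y ≠ c → u y = kelvin m c r u y := by
  have hn : 0 < n := by have := h.dim_eq; omega
  have hcase : ∀ c, (∀ r, 0 < r → KelvinDominates m c r u) ∨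
      ∃ r, 0 < r ∧ ∀ y, y ≠ c → u y = kelvin m c r u y := fun c =>
    (h.kelvinDominates_or_exists_eq hM c).imp_right fun ⟨r, hr, hr'⟩ =>
      ⟨r, hr, fun y hy => eq_kelvin_of_eq_on_puncturedBall hr hr' hy⟩
  refine (hcase c).resolve_left fun hc => ?_
  obtain ⟨a, b, hab⟩ := hnc
  refine (le_of_forall_kelvinDominates (m := m) (fun c' => ?_) a b).not_gt hab
  refine (hcase c').resolve_right fun ⟨r, hr, heq⟩ => ?_
  exact not_forall_kelvinDominates_of_eq_kelvin hn h.pos_dim h.pos hM hr heq hc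

end KelvinInvariance

section BubbleProfile

open Set Filter Topology MeasureTheory Metric EuclideanGeometry
open scoped ContDiff ENNReal

variable {n : ℕ}

local notation "E" => EuclideanSpace ℝ (Fin n)

/-- The rescaling at infinity of the Kelvin transform of `u` in the direction `e`, as a function of
`h = 1 / ‖y‖`, which extends differentiably to `h = 0`. -/
noncomputable def kelvinAtInfinity (m : ℕ) (c : E) (r : ℝ) (u : E → ℝ) (e : E) (h : ℝ) : ℝ :=
  r ^ m * (‖e - h • c‖ ^ 2) ^ (-(m : ℝ) / 2) *
    u (c + (r ^ 2 * h * (‖e - h • c‖ ^ 2)⁻¹) • (e - h • c))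

theorem eventually_eq_kelvinAtInfinity {m : ℕ} {c : E} {r : ℝ} {u : E → ℝ} {e : E}
    (he : ‖e‖ = 1) (heq : ∀ y, y ≠ c → u y = kelvin m c r u y) :
    ∀ᶠ h in 𝓝[>] (0 : ℝ), (h ^ m)⁻¹ * u (h⁻¹ • e) = kelvinAtInfinity m c r u e h := by
  have hcont : ContinuousAt (fun h : ℝ => e - h • c) 0 := by fun_prop
  have hne : ∀ᶠ h in 𝓝 (0 : ℝ), e - h • c ≠ 0 := hcont.eventually_ne (by
    simpa using norm_ne_zero_iff.1 (he.symm ▸ one_ne_zero))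
  filter_upwards [nhdsWithin_le_nhds hne, self_mem_nhdsWithin] with h hh h0
  have h0 : 0 < h := h0
  have hsub : h⁻¹ • e - c = h⁻¹ • (e - h • c) := by
    rw [smul_sub, smul_smul, inv_mul_cancel₀ h0.ne', one_smul]
  have hne : h⁻¹ • e ≠ c := by
    rw [← sub_ne_zero, hsub]
    exact smul_ne_zero (inv_ne_zero h0.ne') hh
  have hN : 0 < ‖e - h • c‖ := norm_pos_iff.2 hh
  have hdist : dist (h⁻¹ • e) c = h⁻¹ * ‖e - h • c‖ := by
    rw [dist_eq_norm, hsub, norm_smul, Real.norm_of_nonneg (by positivity)]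
  rw [heq _ hne, kelvin, inversion, vsub_eq_sub, vadd_eq_add, hdist, hsub, smul_smul,
    kelvinAtInfinity, ← mul_assoc]
  have h1 : (h ^ m)⁻¹ * (r / (h⁻¹ * ‖e - h • c‖)) ^ m =
      r ^ m * (‖e - h • c‖ ^ 2) ^ (-(m : ℝ) / 2) := by
    have h2 : (‖e - h • c‖ ^ 2) ^ (-(m : ℝ) / 2) = (‖e - h • c‖ ^ m)⁻¹ := by
      rw [← Real.rpow_natCast, ← Real.rpow_natCast, ← Real.rpow_mul hN.le, ← Real.rpow_neg hN.le]
      congr 1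
      push_cast
      ring
    rw [h2, div_pow, mul_pow, inv_pow]
    field_simp
  have h3 : (r / (h⁻¹ * ‖e - h • c‖)) ^ 2 * h⁻¹ = r ^ 2 * h * (‖e - h • c‖ ^ 2)⁻¹ := by
    field_simp
  rw [h1, h3, add_comm c]

theorem kelvinAtInfinity_zero (m : ℕ) (c : E) (r : ℝ) (u : E → ℝ) {e : E} (he : ‖e‖ = 1) :
    kelvinAtInfinity m c r u e 0 = r ^ m * u c := by
  simp [kelvinAtInfinity, he]

theorem hasDerivAt_kelvinAtInfinity (m : ℕ) (c : E) (r : ℝ) {u : E → ℝ}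
    (hu : DifferentiableAt ℝ u c) {e : E} (he : ‖e‖ = 1) :
    HasDerivAt (kelvinAtInfinity m c r u e)
      (r ^ m * (m * inner ℝ c e * u c + r ^ 2 * fderiv ℝ u c e)) 0 := by
  have h1 : HasDerivAt (fun h : ℝ => e - h • c) (-c) 0 := by
    simpa using ((hasDerivAt_id (0 : ℝ)).smul_const c).const_sub e
  have h2 : HasDerivAt (fun h : ℝ => ‖e - h • c‖ ^ 2) (-(2 * inner ℝ c e)) 0 := by
    have := h1.norm_sq
    simpa [real_inner_comm] using this
  have h3 : HasDerivAt (fun h : ℝ => (‖e - h • c‖ ^ 2) ^ (-(m : ℝ) / 2)) (m * inner ℝ c e) 0 := by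
    have := h2.rpow_const (p := -(m : ℝ) / 2) (Or.inl (by simp [he]))
    refine this.congr_deriv ?_
    simp [he]
    ring
  have h4 : HasDerivAt (fun h : ℝ => r ^ 2 * h * (‖e - h • c‖ ^ 2)⁻¹) (r ^ 2) 0 := by
    have := ((hasDerivAt_id (0 : ℝ)).const_mul (r ^ 2)).mul (h2.inv (by simp [he]))
    exact this.congr_deriv (by simp [he])
  have h5 : HasDerivAt (fun h : ℝ => c + (r ^ 2 * h * (‖e - h • c‖ ^ 2)⁻¹) • (e - h • c))
      (r ^ 2 • e) 0 := by
    have := (h4.smul h1).const_add c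
    exact this.congr_deriv (by simp)
  have h6 : HasDerivAt (fun h : ℝ => u (c + (r ^ 2 * h * (‖e - h • c‖ ^ 2)⁻¹) • (e - h • c)))
      (fderiv ℝ u c (r ^ 2 • e)) 0 := by
    refine HasFDerivAt.comp_hasDerivAt (0 : ℝ) (l := u) ?_ h5
    simpa using hu.hasFDerivAt
  have h7 := (h3.const_mul (r ^ m)).mul h6
  refine h7.congr_deriv ?_
  simp [he]
  ring

theorem eq_and_deriv_eq_of_eventually_eq_right {f g : ℝ → ℝ} {a b : ℝ} (hf : HasDerivAt f a 0)
    (hg : HasDerivAt g b 0) (h : ∀ᶠ x in 𝓝[>] (0 : ℝ), f x = g x) : f 0 = g 0 ∧ a = b := by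
  have h0 : f 0 = g 0 := by
    have h1 : Tendsto f (𝓝[>] 0) (𝓝 (f 0)) := hf.continuousAt.tendsto.mono_left nhdsWithin_le_nhds
    have h2 : Tendsto g (𝓝[>] 0) (𝓝 (g 0)) := hg.continuousAt.tendsto.mono_left nhdsWithin_le_nhds
    exact tendsto_nhds_unique (h1.congr' h) h2
  refine ⟨h0, ?_⟩
  have h1 : HasDerivWithinAt f b (Ioi 0) 0 :=
    hg.hasDerivWithinAt.congr_of_eventuallyEq h h0
  exact (uniqueDiffWithinAt_Ioi 0).eq_deriv _ hf.hasDerivWithinAt h1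

theorem exists_rpow_eq_add_norm_sq {m : ℕ} (hm : 0 < m) {u : E → ℝ} (hn : 0 < n)
    (hu : Differentiable ℝ u) (hpos : ∀ x, 0 < u x) (hmax : ∀ x, u x ≤ u 0)
    (h : ∀ c : E, ∃ r, 0 < r ∧ ∀ y, y ≠ c → u y = kelvin m c r u y) :
    ∃ a : ℝ, 0 < a ∧ ∀ x, u x ^ (-(2 : ℝ) / m) = u 0 ^ (-(2 : ℝ) / m) + a * ‖x‖ ^ 2 := by
  have hm' : (0 : ℝ) < m := by exact_mod_cast hm
  choose r hr heq using h
  have hD0 : fderiv ℝ u 0 = 0 := IsLocalMax.fderiv_eq_zero (.of_forall hmax)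
  have key : ∀ (c e : E), ‖e‖ = 1 → r c ^ m * u c = r 0 ^ m * u 0 ∧
      m * inner ℝ c e * u c + r c ^ 2 * fderiv ℝ u c e = 0 := by
    intro c e he
    have h1 := eq_and_deriv_eq_of_eventually_eq_right
      (hasDerivAt_kelvinAtInfinity m c (r c) (hu c) he)
      (hasDerivAt_kelvinAtInfinity m 0 (r 0) (hu 0) he)
      (by
        filter_upwards [eventually_eq_kelvinAtInfinity he (heq c),
          eventually_eq_kelvinAtInfinity he (heq 0)] with s h1 h2
        rw [← h1, h2])
    rw [kelvinAtInfinity_zero m c (r c) u he, kelvinAtInfinity_zero m 0 (r 0) u he] at h1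
    refine ⟨h1.1, ?_⟩
    have h2 := h1.2
    rw [hD0] at h2
    simp only [inner_zero_left, mul_zero, zero_mul, _root_.zero_apply, add_zero] at h2
    exact (mul_eq_zero.1 h2).resolve_left (pow_pos (hr c) m).ne'
  set A := r 0 ^ m * u 0
  have hA : 0 < A := mul_pos (pow_pos (hr 0) m) (hpos 0)
  set a := A ^ (-(2 : ℝ) / m)
  have ha : 0 < a := Real.rpow_pos_of_pos hA _
  refine ⟨a, ha, ?_⟩
  set e₀ : E := EuclideanSpace.single ⟨0, hn⟩ 1
  have he₀ : ‖e₀‖ = 1 := by simp [e₀]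
  have hra : ∀ c, u c ^ (-(2 : ℝ) / m) = a * r c ^ 2 := by
    intro c
    have h1 : A = r c ^ m * u c := ((key c e₀ he₀).1).symm
    simp only [a]
    rw [h1, Real.mul_rpow (pow_pos (hr c) m).le (hpos c).le, ← Real.rpow_natCast,
      ← Real.rpow_mul (hr c).le]
    have h2 : (m : ℝ) * (-2 / m) = -2 := by field_simp
    have h3 : (r c) ^ (-2 : ℝ) = (r c ^ 2)⁻¹ := by
      rw [Real.rpow_neg (hr c).le]
      norm_num
    have := hr c
    rw [h2, h3]
    field_simp
  have hderiv : ∀ x, HasFDerivAt (fun x => u x ^ (-(2 : ℝ) / m) - a * ‖x‖ ^ 2)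
      (0 : E →L[ℝ] ℝ) x := by
    intro x
    have h1 : HasFDerivAt (fun x => u x ^ (-(2 : ℝ) / m))
        ((-(2 : ℝ) / m * u x ^ (-(2 : ℝ) / m - 1)) • fderiv ℝ u x) x :=
      (hu x).hasFDerivAt.rpow_const (Or.inl (hpos x).ne')
    have h2 : HasFDerivAt (fun x : E => a * ‖x‖ ^ 2) (a • (2 • innerSL ℝ x)) x :=
      (HasStrictFDerivAt.hasFDerivAt (hasStrictFDerivAt_norm_sq x)).const_mul a
    refine (h1.sub h2).congr_fderiv ?_
    suffices ∀ e : E, ‖e‖ = 1 → (-(2 : ℝ) / m * u x ^ (-(2 : ℝ) / m - 1)) * fderiv ℝ u x e =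
        a * (2 * inner ℝ x e) by
      ext v
      simp only [_root_.sub_apply, _root_.smul_apply, smul_eq_mul,
        nsmul_eq_mul, innerSL_apply_apply, _root_.zero_apply, Nat.cast_ofNat]
      rcases eq_or_ne v 0 with rfl | hv
      · simp
      · have hv0 : ‖v‖ ≠ 0 := norm_ne_zero_iff.2 hv
        have h3 := this (‖v‖⁻¹ • v) (norm_smul_inv_norm hv)
        rw [map_smul, inner_smul_right, smul_eq_mul] at h3
        field_simp at h3 ⊢
        linarith
    intro e he
    have h3 := (key x e he).2
    have h4 : u x ^ (-(2 : ℝ) / m - 1) = a * r x ^ 2 / u x := by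
      rw [Real.rpow_sub_one (hpos x).ne', hra]
    rw [h4]
    have hux := hpos x
    have h5 : r x ^ 2 * fderiv ℝ u x e = - (m * inner ℝ x e * u x) := by linarith
    calc _ = -2 / (m * u x) * a * (r x ^ 2 * fderiv ℝ u x e) := by field_simp
      _ = _ := by
        rw [h5]
        field_simp
  intro x
  have h1 := is_const_of_fderiv_eq_zero (𝕜 := ℝ) (fun x => (hderiv x).differentiableAt)
    (fun x => (hderiv x).fderiv) x 0
  simp only [norm_zero] at h1
  linarith

end BubbleProfile

section BubbleBilaplacian

open Set Filter Topology MeasureTheory Metric EuclideanGeometry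
open scoped ContDiff ENNReal

variable {n : ℕ}

local notation "E" => EuclideanSpace ℝ (Fin n)

theorem hasDerivAt_add_mul_rpow {a b : ℝ} (ha : 0 < a) (hb : 0 < b) (k q : ℝ) {s : ℝ}
    (hs : 0 ≤ s) :
    HasDerivAt (fun s => k * (b + a * s) ^ q) (k * q * a * (b + a * s) ^ (q - 1)) s := by
  have h1 : HasDerivAt (fun s => b + a * s) a s := by
    simpa using ((hasDerivAt_id s).const_mul a).const_add b
  have h2 := (h1.rpow_const (p := q) (Or.inl (by positivity))).const_mul k
  exact h2.congr_deriv (by ring)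

theorem lap_lap_bubble_zero {a b : ℝ} (ha : 0 < a) (hb : 0 < b) (q : ℝ) :
    lap (lap fun x : E => (b + a * ‖x‖ ^ 2) ^ q) 0 =
      4 * n * (n + 2) * (q * (q - 1) * a ^ 2 * b ^ (q - 2)) := by
  have hlap : (lap fun x : E => (b + a * ‖x‖ ^ 2) ^ q) = fun x =>
      (fun s => 2 * n * (q * a * (b + a * s) ^ (q - 1)) +
        4 * s * (q * a * (q - 1) * a * (b + a * s) ^ (q - 1 - 1))) (‖x‖ ^ 2) := by
    funext x
    refine lap_comp_norm_sq (h := fun s => (b + a * s) ^ q)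
      (h₁ := fun s => q * a * (b + a * s) ^ (q - 1))
      (h₂ := fun s => q * a * (q - 1) * a * (b + a * s) ^ (q - 1 - 1)) ?_ ?_ x
    · intro s hs
      simpa using hasDerivAt_add_mul_rpow ha hb 1 q hs
    · intro s hs
      exact hasDerivAt_add_mul_rpow ha hb (q * a) (q - 1) hs
  rw [hlap]
  set k₂ := q * a * (q - 1) * a
  set k₃ := k₂ * (q - 1 - 1) * a
  set k₄ := k₃ * (q - 1 - 1 - 1) * a
  have d₁ : ∀ s : ℝ, 0 ≤ s → HasDerivAt (fun s => q * a * (b + a * s) ^ (q - 1))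
      (k₂ * (b + a * s) ^ (q - 1 - 1)) s := fun s hs =>
    hasDerivAt_add_mul_rpow ha hb (q * a) (q - 1) hs
  have d₂ : ∀ s : ℝ, 0 ≤ s → HasDerivAt (fun s => k₂ * (b + a * s) ^ (q - 1 - 1))
      (k₃ * (b + a * s) ^ (q - 1 - 1 - 1)) s := fun s hs =>
    hasDerivAt_add_mul_rpow ha hb k₂ (q - 1 - 1) hs
  have d₃ : ∀ s : ℝ, 0 ≤ s → HasDerivAt (fun s => k₃ * (b + a * s) ^ (q - 1 - 1 - 1))
      (k₄ * (b + a * s) ^ (q - 1 - 1 - 1 - 1)) s := fun s hs =>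
    hasDerivAt_add_mul_rpow ha hb k₃ (q - 1 - 1 - 1) hs
  have d₀ : ∀ s : ℝ, HasDerivAt (fun s => 4 * s) 4 s := fun s => by
    simpa using (hasDerivAt_id s).const_mul (4 : ℝ)
  rw [lap_comp_norm_sq
    (h := fun s => 2 * n * (q * a * (b + a * s) ^ (q - 1)) +
      4 * s * (k₂ * (b + a * s) ^ (q - 1 - 1)))
    (h₁ := fun s => 2 * n * (k₂ * (b + a * s) ^ (q - 1 - 1)) +
      (4 * (k₂ * (b + a * s) ^ (q - 1 - 1)) + 4 * s * (k₃ * (b + a * s) ^ (q - 1 - 1 - 1))))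
    (h₂ := fun s => 2 * n * (k₃ * (b + a * s) ^ (q - 1 - 1 - 1)) +
      (4 * (k₃ * (b + a * s) ^ (q - 1 - 1 - 1)) + (4 * (k₃ * (b + a * s) ^ (q - 1 - 1 - 1)) +
        4 * s * (k₄ * (b + a * s) ^ (q - 1 - 1 - 1 - 1)))))
    (fun s hs => ((d₁ s hs).const_mul _).add ((d₀ s).mul (d₂ s hs)))
    (fun s hs => ((d₂ s hs).const_mul _).add
      (((d₂ s hs).const_mul _).add ((d₀ s).mul (d₃ s hs))))]
  have hq : q - 1 - 1 = q - 2 := by ring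
  simp only [norm_zero, k₂, hq]
  norm_num
  ring

theorem bubble_coefficient_eq {m : ℕ} (hn : n = m + 4) (hm : 0 < m) {a : ℝ} (ha : 0 < a)
    (h : 4 * n * (n + 2) * ((-(m : ℝ) / 2) * (-(m : ℝ) / 2 - 1) * a ^ 2 *
      (1 / 2 : ℝ) ^ (-(m : ℝ) / 2 - 2)) =
        n * m * ((n : ℝ) ^ 2 - 4) / 16 * ((1 / 2 : ℝ) ^ (-(m : ℝ) / 2)) ^ (((m : ℝ) + 8) / m)) :
    a = 1 / 2 := by
  have hm' : (0 : ℝ) < m := by exact_mod_cast hm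
  have hn' : (n : ℝ) = m + 4 := by exact_mod_cast hn
  have h1 : ((1 / 2 : ℝ) ^ (-(m : ℝ) / 2)) ^ (((m : ℝ) + 8) / m) =
      (1 / 2 : ℝ) ^ (-(m : ℝ) / 2 - 2) * 4 := by
    rw [← Real.rpow_mul (by norm_num)]
    have : -(m : ℝ) / 2 * ((m + 8) / m) = (-(m : ℝ) / 2 - 2) + (-2 : ℝ) := by
      field_simp
      ring
    rw [this, Real.rpow_add (by norm_num)]
    congr 1
    rw [Real.rpow_neg (by norm_num)]
    norm_num
  rw [h1] at h
  have hP : 0 < (1 / 2 : ℝ) ^ (-(m : ℝ) / 2 - 2) := by positivity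
  set P := (1 / 2 : ℝ) ^ (-(m : ℝ) / 2 - 2)
  have h2 : (n : ℝ) * (n + 2) * m * (m + 2) * P * (a ^ 2 - 1 / 4) = 0 := by
    rw [hn'] at h ⊢
    linear_combination h
  have h3 : a ^ 2 - 1 / 4 = 0 := by
    refine (mul_eq_zero.1 h2).resolve_left ?_
    rw [hn']
    positivity
  nlinarith

end BubbleBilaplacian

/-- normalized form of C. S. Lin's classification: a smooth positive entire
solution of `Δ²w = (n(n−4)(n²−4)/16) w^{(n+4)/(n−4)}` with `w(0) = sup w = 2^{(n−4)/2}`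
is the standard spherical bubble `((1+|x|²)/2)^{(4−n)/2}`. -/
theorem lin_classification_normalized (n : ℕ) (hn : 5 ≤ n)
    (w : EuclideanSpace ℝ (Fin n) → ℝ)
    (hreg : ContDiff ℝ (⊤ : ℕ∞) w) (hpos : ∀ x, 0 < w x)
    (heq : ∀ x : EuclideanSpace ℝ (Fin n),
      lap (lap w) x = ((n : ℝ) * ((n : ℝ) - 4) * ((n : ℝ)^2 - 4)/16)
        * w x ^ (((n : ℝ) + 4)/((n : ℝ) - 4)))
    (hval : w 0 = (2 : ℝ) ^ (((n : ℝ) - 4)/2))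
    (hsup : ∀ x, w x ≤ w 0) :
    ∀ x : EuclideanSpace ℝ (Fin n), w x = ((1 + ‖x‖^2)/2) ^ (((4 : ℝ) - (n : ℝ))/2) := by
  obtain ⟨m, hnm⟩ : ∃ m, n = m + 4 := ⟨n - 4, by omega⟩
  have hm : 0 < m := by omega
  have hm' : (0 : ℝ) < m := by exact_mod_cast hm
  have hn' : (n : ℝ) = m + 4 := by exact_mod_cast hnm
  have e1 : (n : ℝ) - 4 = m := by linarith
  have e2 : (n : ℝ) + 4 = m + 8 := by linarith
  have e3 : (4 : ℝ) - n = -m := by linarith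
  rw [e1, e2] at heq
  rw [e1] at hval
  rw [e3]
  have hκ : 0 < (n : ℝ) * m * ((n : ℝ) ^ 2 - 4) / 16 := by
    have : 0 < (n : ℝ) ^ 2 - 4 := by rw [hn']; nlinarith
    have : (0 : ℝ) < n := by rw [hn']; positivity
    positivity
  have hp : 1 ≤ ((m : ℝ) + 8) / m := by
    rw [one_le_div hm']
    linarith
  obtain ⟨C, hC, hrep⟩ := exists_integral_representation hnm hreg hpos hsup hκ hp heq
  have hR : IsRieszSolution m C (((m : ℝ) + 8) / m) w :=
    ⟨hnm, hm, hC, rfl, hreg.continuous, hpos, fun x => (hrep x).1, fun x => (hrep x).2⟩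
  have hnc : ∃ a b, w a < w b := by
    by_contra! hcon
    have hw : w = fun _ => w 0 := funext fun x => le_antisymm (hsup x) (hcon x 0)
    have hlap : lap w = fun _ => 0 := by
      rw [hw]
      funext x
      simp [lap, iteratedFDeriv_const_of_ne]
    have h0 := heq 0
    rw [hlap] at h0
    have h1 : lap (fun _ : EuclideanSpace ℝ (Fin n) => (0 : ℝ)) 0 = 0 := by
      simp [lap]
    rw [h1] at h0
    exact (mul_pos hκ (Real.rpow_pos_of_pos (hpos 0) _)).ne h0
  obtain ⟨a, ha, hform⟩ := exists_rpow_eq_add_norm_sq hm (by omega)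
    (hreg.differentiable (by simp)) hpos hsup fun c => hR.exists_eq_kelvin hsup hnc c
  have hb : w 0 ^ (-(2 : ℝ) / m) = 1 / 2 := by
    rw [hval, ← Real.rpow_mul (by norm_num)]
    have : (m : ℝ) / 2 * (-2 / m) = -1 := by field_simp
    rw [this, Real.rpow_neg_one]
    norm_num
  have hw : w = fun x => (1 / 2 + a * ‖x‖ ^ 2) ^ (-(m : ℝ) / 2) := by
    funext x
    rw [← hb, ← hform, ← Real.rpow_mul (hpos x).le]
    have : -(2 : ℝ) / m * (-m / 2) = 1 := by field_simp
    rw [this, Real.rpow_one]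
  have hlap := heq 0
  have ha2 : a = 1 / 2 := by
    rw [hw, lap_lap_bubble_zero ha (by norm_num)] at hlap
    refine bubble_coefficient_eq hnm hm ha ?_
    simpa using hlap
  intro x
  rw [hw, ha2]
  simp only
  congr 1
  ring
end
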